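/- Let X be a proper geodesic Gromov hyperbolic space equipped with a proper, isometric, non-elementary action of a group Γ. Let G be an infinite confined subgroup of infinite index in Γ, with finite confining subset P, and assume every non-trivial element of P is loxodromic. Then G contains an infinite sequence of loxodromic elements h_n that escapes to infinity, i.e. d(o, G·Ax(h_n)) → ∞ for any basepoint o. -/

import Mathlib

/-!
STATEMENT 16. Let `X` be a proper geodesic Gromov hyperbolic space with a proper, isometric
and non-elementary action of `Γ`.  Let `G` be an infinite confined subgroup of infinite index
in `Γ` with a finite confining subset `P`, every non-trivial element of which is loxodromic.
Then `G` has an infinite sequence of loxodromic elements `hₙ` escaping to infinity, i.e.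
`d(o, G·Ax(hₙ)) → ∞`.
-/

open Metric Filter Set Real

noncomputable section

namespace GromovScaffold

variable {X : Type*} [MetricSpace X]

/-- The Gromov product of `x` and `y` seen from `o`. -/
def gprod (o x y : X) : ℝ := (dist x o + dist y o - dist x y) / 2

/-- `X` is `δ`-hyperbolic in the sense of Gromov (four point condition, which for geodesic
spaces is equivalent, up to changing the constant, to the thin triangles condition). -/
def IsGromovHyperbolic (X : Type*) [MetricSpace X] (δ : ℝ) : Prop :=
  ∀ o x y z : X, min (gprod o x z) (gprod o z y) - δ ≤ gprod o x y

/-- `f` restricted to `s` is a unit-speed geodesic. -/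
def IsGeodesicOn (f : ℝ → X) (s : Set ℝ) : Prop :=
  ∀ u ∈ s, ∀ v ∈ s, dist (f u) (f v) = |u - v|

/-- Every pair of points of `X` is joined by a geodesic segment. -/
def GeodesicSpace (X : Type*) [MetricSpace X] : Prop :=
  ∀ x y : X, ∃ f : ℝ → X, f 0 = x ∧ f (dist x y) = y ∧ IsGeodesicOn f (Icc 0 (dist x y))

/-- A geodesic ray in `X` (parametrised by `[0,∞)`; the values for negative times are
irrelevant). -/
structure GeodesicRay (X : Type*) [MetricSpace X] where
  toFun : ℝ → X
  geodesic : IsGeodesicOn toFun (Ici 0)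

/-- Two rays are asymptotic if they stay at bounded distance from each other. -/
def GeodesicRay.Asymp (r₁ r₂ : GeodesicRay X) : Prop :=
  ∃ C : ℝ, ∀ t ≥ (0 : ℝ), dist (r₁.toFun t) (r₂.toFun t) ≤ C

theorem asymp_equivalence (X : Type*) [MetricSpace X] :
    Equivalence (GeodesicRay.Asymp (X := X)) := by
  constructor
  · exact fun r => ⟨0, fun t _ => by simp⟩
  · rintro r₁ r₂ ⟨C, hC⟩
    exact ⟨C, fun t ht => by rw [dist_comm]; exact hC t ht⟩
  · rintro r₁ r₂ r₃ ⟨C, hC⟩ ⟨D, hD⟩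
    exact ⟨C + D, fun t ht =>
      (dist_triangle _ (r₂.toFun t) _).trans (add_le_add (hC t ht) (hD t ht))⟩

/-- The setoid of asymptotic geodesic rays. -/
def raySetoid (X : Type*) [MetricSpace X] : Setoid (GeodesicRay X) :=
  ⟨GeodesicRay.Asymp, asymp_equivalence X⟩

/-- The Gromov boundary of `X`: asymptotic classes of geodesic rays. -/
def GromovBoundary (X : Type*) [MetricSpace X] := Quotient (raySetoid X)

/-- The boundary point determined by a ray. -/
def GeodesicRay.pt (r : GeodesicRay X) : GromovBoundary X := Quotient.mk (raySetoid X) r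

/-- The image of a geodesic ray under an isometry. -/
def rayMap (g : X ≃ᵢ X) (r : GeodesicRay X) : GeodesicRay X :=
  ⟨fun t => g (r.toFun t), fun u hu v hv => by
    rw [g.dist_eq]; exact r.geodesic u hu v hv⟩

/-- The induced action of an isometry on the Gromov boundary. -/
def bmap (g : X ≃ᵢ X) : GromovBoundary X → GromovBoundary X :=
  Quotient.map (rayMap g) (by
    rintro r₁ r₂ ⟨C, hC⟩
    exact ⟨C, fun t ht => by simpa [rayMap, g.dist_eq] using hC t ht⟩)

/-- A sequence `x : ℕ → X` converges to the boundary point `ξ`: the Gromov products with a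
representing ray go to infinity. -/
def SeqConv (o : X) (x : ℕ → X) (ξ : GromovBoundary X) : Prop :=
  ∃ r : GeodesicRay X, r.pt = ξ ∧
    Tendsto (fun p : ℕ × ℕ => gprod o (x p.1) (r.toFun p.2)) atTop atTop

/-- The limit set of a group of isometries: accumulation points of the orbit `G • o` on the
Gromov boundary. -/
def limitSet (G : Subgroup (X ≃ᵢ X)) (o : X) : Set (GromovBoundary X) :=
  {ξ | ∃ g : ℕ → G, Tendsto (fun n => dist o ((g n : X ≃ᵢ X) o)) atTop atTop ∧
    SeqConv o (fun n => (g n : X ≃ᵢ X) o) ξ}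

/-- `ξ` is a conical limit point of `G`: `ξ ∈ ΛG` and there are `R > 0`, a geodesic ray `σ`
ending at `ξ` and a sequence `gₙ ∈ G` with `gₙ o → ξ` and `d(gₙ o, σ) ≤ R`. -/
def conicalSet (G : Subgroup (X ≃ᵢ X)) (o : X) : Set (GromovBoundary X) :=
  {ξ | ξ ∈ limitSet G o ∧ ∃ R > (0 : ℝ), ∃ σ : GeodesicRay X, σ.pt = ξ ∧ ∃ g : ℕ → G,
    SeqConv o (fun n => (g n : X ≃ᵢ X) o) ξ ∧
    ∀ n, infDist ((g n : X ≃ᵢ X) o) (σ.toFun '' Ici 0) ≤ R}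

/-- The non-conical limit set. -/
def nonconicalSet (G : Subgroup (X ≃ᵢ X)) (o : X) : Set (GromovBoundary X) :=
  limitSet G o \ conicalSet G o

/-- The critical exponent `δ_G = limsup (1/n) log #{g ∈ G : d(o, g o) ≤ n}`. -/
def critExp (G : Subgroup (X ≃ᵢ X)) (o : X) : ℝ :=
  limsup (fun n : ℕ =>
    Real.log (Set.ncard {g : X ≃ᵢ X | g ∈ G ∧ dist o (g o) ≤ n}) / n) atTop

/-- The action of `G` on `X` is properly discontinuous. -/
def ProperAct (G : Subgroup (X ≃ᵢ X)) : Prop :=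
  ∀ (x : X) (R : ℝ), {g : X ≃ᵢ X | g ∈ G ∧ dist x (g x) ≤ R}.Finite

/-- A bi-infinite geodesic in `X`. -/
structure GeodesicLine (X : Type*) [MetricSpace X] where
  toFun : ℝ → X
  geodesic : IsGeodesicOn toFun univ

/-- The positive geodesic ray of a line. -/
def GeodesicLine.posRay (l : GeodesicLine X) : GeodesicRay X :=
  ⟨l.toFun, fun u _ v _ => l.geodesic u trivial v trivial⟩

/-- The negative geodesic ray of a line. -/
def GeodesicLine.negRay (l : GeodesicLine X) : GeodesicRay X :=
  ⟨fun t => l.toFun (-t), fun u _ v _ => by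
    rw [l.geodesic (-u) trivial (-v) trivial, neg_sub_neg, abs_sub_comm]⟩

/-- The line `l` joins the boundary points `ξ` and `η`. -/
def Joins (l : GeodesicLine X) (ξ η : GromovBoundary X) : Prop :=
  l.posRay.pt = ξ ∧ l.negRay.pt = η

/-- The given metric on the Gromov boundary is a visual metric with parameter `ε` and
basepoint `o`: `dist ξ η ≍ exp (-ε d(o, [ξ,η]))` with a uniform multiplicative constant. -/
def IsVisualMetric (o : X) (ε : ℝ) [MetricSpace (GromovBoundary X)] : Prop :=
  ∃ C ≥ (1 : ℝ), ∀ ξ η : GromovBoundary X, ∀ l : GeodesicLine X, Joins l ξ η →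
    dist ξ η ≤ C * Real.exp (-ε * infDist o (range l.toFun)) ∧
    Real.exp (-ε * infDist o (range l.toFun)) / C ≤ dist ξ η

end GromovScaffold

namespace GromovScaffold

variable {X : Type*} [MetricSpace X]

/-- `h` is loxodromic: it has exactly two fixed points on the Gromov boundary. -/
def IsLoxodromic (h : X ≃ᵢ X) : Prop :=
  ∃ p q : GromovBoundary X, p ≠ q ∧ {ξ : GromovBoundary X | bmap h ξ = ξ} = {p, q}

/-- The (quasi-)axis of a loxodromic isometry: the union of all bi-infinite geodesics joining
its two boundary fixed points. -/
def axisSet (h : X ≃ᵢ X) : Set X :=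
  {x | ∃ l : GeodesicLine X, (∃ p q : GromovBoundary X, p ≠ q ∧
      {ξ : GromovBoundary X | bmap h ξ = ξ} = {p, q} ∧ Joins l p q) ∧ x ∈ range l.toFun}

/-- `G·Ax(h)`, the union of the `G`-translates of the axis of `h`. -/
def GAxis (G : Subgroup (X ≃ᵢ X)) (h : X ≃ᵢ X) : Set X :=
  ⋃ g ∈ (G : Set (X ≃ᵢ X)), g '' axisSet h

/-- The action has non-elementary limit set: at least three points. -/
def NonElementary (G : Subgroup (X ≃ᵢ X)) (o : X) : Prop :=
  ∃ a b c : GromovBoundary X, a ∈ limitSet G o ∧ b ∈ limitSet G o ∧ c ∈ limitSet G o ∧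
    a ≠ b ∧ a ≠ c ∧ b ≠ c

end GromovScaffold

open GromovScaffold

open scoped Topology

section Basics

variable {X : Type*} [MetricSpace X] {δ : ℝ}

theorem gprod_comm (o x y : X) : gprod o x y = gprod o y x := by
  simp only [gprod, dist_comm x y]; ring

theorem gprod_nonneg (o x y : X) : 0 ≤ gprod o x y := by
  have := dist_triangle_right x y o
  simp only [gprod]; linarith

theorem gprod_le_dist_left (o x y : X) : gprod o x y ≤ dist o x := by
  have := dist_triangle_left y o x
  simp only [gprod]; rw [dist_comm o x, dist_comm y o] at *
  rw [dist_comm o y] at *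
  linarith

theorem gprod_le_dist_right (o x y : X) : gprod o x y ≤ dist o y := by
  rw [gprod_comm]; exact gprod_le_dist_left o y x

theorem gprod_base_change (o o' x y : X) : gprod o x y - dist o o' ≤ gprod o' x y := by
  have h1 := dist_triangle x o' o
  have h2 := dist_triangle y o' o
  rw [dist_comm o' o] at h1 h2
  simp only [gprod]; linarith

theorem gprod_lipschitz_left (o x x' y : X) : gprod o x y - dist x x' ≤ gprod o x' y := by
  have h1 := dist_triangle x x' o
  have h2 := dist_triangle x' x y
  rw [dist_comm x' x] at h2
  simp only [gprod]; linarith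

theorem gprod_lipschitz_right (o x y y' : X) : gprod o x y - dist y y' ≤ gprod o x y' := by
  rw [gprod_comm o x y, gprod_comm o x y']; exact gprod_lipschitz_left o y y' x

theorem gprod_map (g : X ≃ᵢ X) (o x y : X) : gprod (g o) (g x) (g y) = gprod o x y := by
  simp only [gprod, g.dist_eq]

theorem gprod_add_gprod (o x y : X) : gprod o x y + gprod x o y = dist o x := by
  simp only [gprod, dist_comm x o, dist_comm y o, dist_comm y x]; ring

theorem GromovScaffold.IsGromovHyperbolic.le_gprod (h : IsGromovHyperbolic X δ) {o x y z : X}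
    {M : ℝ} (h1 : M ≤ gprod o x z) (h2 : M ≤ gprod o z y) : M - δ ≤ gprod o x y :=
  (sub_le_sub_right (le_min h1 h2) δ).trans (h o x y z)

theorem GromovScaffold.IsGromovHyperbolic.four_point (h : IsGromovHyperbolic X δ) (x y z w : X) :
    dist x y + dist z w ≤ max (dist x z + dist y w) (dist x w + dist y z) + 2 * δ := by
  have := h w x y z
  simp only [gprod] at this
  rw [dist_comm z y] at this
  rcases le_total (dist x z + dist y w) (dist x w + dist y z) with h1 | h1
  · rw [max_eq_right h1]
    rw [min_eq_right (by linarith)] at this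
    linarith
  · rw [max_eq_left h1]
    rw [min_eq_left (by linarith)] at this
    linarith

theorem tendsto_gprod_right {ι : Type*} {l : Filter ι} {u : ι → X} {y : X} (o x : X)
    (h : Tendsto u l (𝓝 y)) : Tendsto (fun i => gprod o x (u i)) l (𝓝 (gprod o x y)) := by
  simp only [gprod]
  exact ((tendsto_const_nhds.add (h.dist tendsto_const_nhds)).sub
    (tendsto_const_nhds.dist h)).div_const 2

theorem exists_ultralimit [ProperSpace X] (U : Ultrafilter ℕ) {u : ℕ → X} {o : X} {R : ℝ}
    (h : ∀ᶠ n in (U : Filter ℕ), dist o (u n) ≤ R) :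
    ∃ y, Tendsto u U (𝓝 y) := by
  have hmem : ∀ᶠ n in (U : Filter ℕ), u n ∈ closedBall o R := by
    filter_upwards [h] with n hn
    rwa [mem_closedBall, dist_comm]
  obtain ⟨y, -, hy⟩ := (isCompact_closedBall o R).ultrafilter_le_nhds (U.map u)
    (le_principal_iff.2 hmem)
  exact ⟨y, hy⟩

end Basics

section Rays

variable {X : Type*} [MetricSpace X] {δ : ℝ}

theorem ray_dist (r : GeodesicRay X) {s t : ℝ} (hs : 0 ≤ s) (ht : 0 ≤ t) :
    dist (r.toFun s) (r.toFun t) = |s - t| := r.geodesic s hs t ht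

theorem ray_dist_base_le (r : GeodesicRay X) (o : X) {t : ℝ} (ht : 0 ≤ t) :
    dist o (r.toFun t) ≤ t + dist o (r.toFun 0) := by
  have h1 := dist_triangle o (r.toFun 0) (r.toFun t)
  rw [ray_dist r le_rfl ht, zero_sub, abs_neg, abs_of_nonneg ht] at h1
  linarith

theorem le_ray_dist_base (r : GeodesicRay X) (o : X) {t : ℝ} (ht : 0 ≤ t) :
    t - dist o (r.toFun 0) ≤ dist o (r.toFun t) := by
  have h1 := dist_triangle_left (r.toFun 0) (r.toFun t) o
  rw [ray_dist r le_rfl ht, zero_sub, abs_neg, abs_of_nonneg ht] at h1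
  linarith

theorem le_gprod_ray (r : GeodesicRay X) (o : X) {s t : ℝ} (hs : 0 ≤ s) (hst : s ≤ t) :
    s - dist o (r.toFun 0) ≤ gprod o (r.toFun s) (r.toFun t) := by
  have h := gprod_base_change (r.toFun 0) o (r.toFun s) (r.toFun t)
  have h2 : gprod (r.toFun 0) (r.toFun s) (r.toFun t) = s := by
    simp only [gprod]
    rw [ray_dist r hs le_rfl, ray_dist r (hs.trans hst) le_rfl, ray_dist r hs (hs.trans hst),
      sub_zero, sub_zero, abs_of_nonneg hs, abs_of_nonneg (hs.trans hst),
      abs_of_nonpos (by linarith)]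
    ring
  rw [h2, dist_comm] at h
  exact h

/-- Rays having points with arbitrarily large Gromov product are asymptotic. -/
theorem asymp_of_gprod (hhyp : IsGromovHyperbolic X δ) (r s : GeodesicRay X) (o : X)
    (h : ∀ M : ℝ, ∃ T ≥ (0 : ℝ), ∃ S ≥ (0 : ℝ), M ≤ gprod o (r.toFun T) (s.toFun S)) :
    r.Asymp s := by
  set d₁ := dist o (r.toFun 0) with hd₁
  set d₂ := dist o (s.toFun 0) with hd₂
  have p₁ : 0 ≤ d₁ := dist_nonneg
  have p₂ : 0 ≤ d₂ := dist_nonneg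
  refine ⟨3 * d₁ + 3 * d₂ + 4 * δ, fun t ht => ?_⟩
  obtain ⟨T, hT, S, hS, hM⟩ := h (t + d₁ + d₂)
  have hT' : t ≤ T := by
    have := hM.trans ((gprod_le_dist_left _ _ _).trans (ray_dist_base_le r o hT))
    linarith
  have hS' : t ≤ S := by
    have := hM.trans ((gprod_le_dist_right _ _ _).trans (ray_dist_base_le s o hS))
    linarith
  have e₁ := le_gprod_ray r o ht hT'
  have e₂ := le_gprod_ray s o ht hS'
  rw [gprod_comm] at e₂
  have e₃ : t - d₁ - d₂ - δ ≤ gprod o (r.toFun T) (s.toFun t) :=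
    hhyp.le_gprod (z := s.toFun S) (by linarith) (by linarith)
  have hδ : 0 ≤ δ := by
    have := hhyp o o o o
    simp [gprod] at this
    exact this
  have e₄ : t - d₁ - d₂ - δ - δ ≤ gprod o (r.toFun t) (s.toFun t) :=
    hhyp.le_gprod (z := r.toFun T) (by linarith) e₃
  have f₁ := ray_dist_base_le r o ht
  have f₂ := ray_dist_base_le s o ht
  rw [dist_comm] at f₁ f₂
  simp only [gprod] at e₄
  linarith

theorem pt_eq_iff {r s : GeodesicRay X} : r.pt = s.pt ↔ r.Asymp s := Quotient.eq (r := raySetoid X)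

theorem bmap_pt (g : X ≃ᵢ X) (r : GeodesicRay X) : bmap g r.pt = (rayMap g r).pt := rfl

theorem exists_pt_eq (ξ : GromovBoundary X) : ∃ r : GeodesicRay X, r.pt = ξ := Quotient.exists_rep ξ

/-- The sequence `x` converges to the endpoint of the ray `r`. -/
def RayConv (o : X) (x : ℕ → X) (r : GeodesicRay X) : Prop :=
  ∀ M : ℝ, ∃ N : ℕ, ∀ n ≥ N, ∀ m ≥ N, M ≤ gprod o (x n) (r.toFun m)

theorem exists_rayConv_of_seqConv {o : X} {x : ℕ → X} {ξ : GromovBoundary X} (h : SeqConv o x ξ) :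
    ∃ r : GeodesicRay X, r.pt = ξ ∧ RayConv o x r := by
  obtain ⟨r, hr, h⟩ := h
  refine ⟨r, hr, fun M => ?_⟩
  obtain ⟨⟨a, b⟩, hab⟩ := eventually_atTop.1 (tendsto_atTop.1 h M)
  exact ⟨max a b, fun n hn m hm => hab (n, m)
    ⟨(le_max_left a b).trans hn, (le_max_right a b).trans hm⟩⟩

theorem RayConv.congr_dist {o : X} {x y : ℕ → X} {r : GeodesicRay X} (h : RayConv o x r) {D : ℝ}
    (hD : ∀ n, dist (x n) (y n) ≤ D) : RayConv o y r := fun M => by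
  obtain ⟨N, hN⟩ := h (M + D)
  refine ⟨N, fun n hn m hm => ?_⟩
  have := gprod_lipschitz_left o (x n) (y n) (r.toFun m)
  linarith [hN n hn m hm, hD n]

theorem RayConv.base_change {o : X} {x : ℕ → X} {r : GeodesicRay X} (h : RayConv o x r) (o' : X) :
    RayConv o' x r := fun M => by
  obtain ⟨N, hN⟩ := h (M + dist o o')
  refine ⟨N, fun n hn m hm => ?_⟩
  linarith [hN n hn m hm, gprod_base_change o o' (x n) (r.toFun m)]

theorem RayConv.map {o : X} {x : ℕ → X} {r : GeodesicRay X} (h : RayConv o x r) (g : X ≃ᵢ X) :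
    RayConv o (fun n => g (x n)) (rayMap g r) := by
  have : RayConv (g o) (fun n => g (x n)) (rayMap g r) := fun M => by
    obtain ⟨N, hN⟩ := h M
    exact ⟨N, fun n hn m hm => (hN n hn m hm).trans_eq (gprod_map g _ _ _).symm⟩
  exact this.base_change o

theorem RayConv.asymp {o : X} {x y : ℕ → X} {r s : GeodesicRay X} (hhyp : IsGromovHyperbolic X δ)
    (hx : RayConv o x r) (hy : RayConv o y s)
    (h : ∀ M : ℝ, ∀ N : ℕ, ∃ n ≥ N, ∃ m ≥ N, M ≤ gprod o (x n) (y m)) : r.Asymp s := by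
  refine asymp_of_gprod hhyp r s o fun M => ?_
  obtain ⟨N₁, h₁⟩ := hx (M + 2 * |δ|)
  obtain ⟨N₂, h₂⟩ := hy (M + 2 * |δ|)
  obtain ⟨n, hn, m, hm, h₃⟩ := h (M + 2 * |δ|) (max N₁ N₂)
  have e₁ := h₁ n ((le_max_left _ _).trans hn) n ((le_max_left _ _).trans hn)
  have e₂ := h₂ m ((le_max_right _ _).trans hm) m ((le_max_right _ _).trans hm)
  rw [gprod_comm] at e₁
  have e₄ := hhyp.le_gprod e₁ h₃
  have := le_abs_self δ
  have := abs_nonneg δ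
  have e₅ : M + |δ| - δ ≤ _ := hhyp.le_gprod (M := M + |δ|) (by linarith) (by linarith)
  exact ⟨n, n.cast_nonneg, m, m.cast_nonneg, le_trans (by linarith) e₅⟩

theorem RayConv.congr_asymp {o : X} {x : ℕ → X} {r s : GeodesicRay X} (h : RayConv o x r)
    (hrs : r.Asymp s) : RayConv o x s := fun M => by
  obtain ⟨C, hC⟩ := hrs
  obtain ⟨N, hN⟩ := h (M + C)
  refine ⟨N, fun n hn m hm => ?_⟩
  linarith [hN n hn m hm, gprod_lipschitz_right o (x n) (r.toFun m) (s.toFun m),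
    hC m m.cast_nonneg]

/-- A sequence converging to infinity converges to the endpoint of some geodesic ray. -/
theorem exists_rayConv [ProperSpace X] (hhyp : IsGromovHyperbolic X δ) (hgeo : GeodesicSpace X)
    (o : X) (x : ℕ → X)
    (h : ∀ M : ℝ, ∃ N : ℕ, ∀ n ≥ N, ∀ m ≥ N, M ≤ gprod o (x n) (x m)) :
    ∃ r : GeodesicRay X, RayConv o x r := by
  choose f hf0 hf1 hf using fun n => hgeo o (x n)
  set U := hyperfilter ℕ with hU
  have hUle : (U : Filter ℕ) ≤ atTop := Nat.hyperfilter_le_atTop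
  have hlen : ∀ t : ℝ, ∀ᶠ n in (U : Filter ℕ), t ≤ dist o (x n) := fun t => by
    apply hUle
    obtain ⟨N, hN⟩ := h t
    filter_upwards [eventually_ge_atTop N] with n hn
    exact (hN n hn n hn).trans (gprod_le_dist_left _ _ _)
  have hdist : ∀ s t : ℝ, 0 ≤ s → 0 ≤ t → ∀ᶠ n in (U : Filter ℕ),
      dist (f n s) (f n t) = |s - t| := fun s t hs ht => by
    filter_upwards [hlen s, hlen t] with n h1 h2
    exact hf n s ⟨hs, h1⟩ t ⟨ht, h2⟩
  have hex : ∀ t : ℝ, ∃ y, 0 ≤ t → Tendsto (fun n => f n t) U (𝓝 y) := fun t => by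
    by_cases ht : 0 ≤ t
    · obtain ⟨y, hy⟩ := exists_ultralimit U (u := fun n => f n t) (o := o) (R := t) (by
        filter_upwards [hdist 0 t le_rfl ht] with n hn
        rw [hf0, zero_sub, abs_neg, abs_of_nonneg ht] at hn
        exact hn.le)
      exact ⟨y, fun _ => hy⟩
    · exact ⟨o, fun h => absurd h ht⟩
  choose r hr using hex
  refine ⟨⟨r, fun s hs t ht => ?_⟩, fun M => ?_⟩
  · refine tendsto_nhds_unique ((hr s hs).dist (hr t ht)) ?_
    exact tendsto_const_nhds.congr' (by
      filter_upwards [hdist s t hs ht] with n hn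
      exact hn.symm)
  · obtain ⟨N, hN⟩ := h (M + δ)
    obtain ⟨N', hN'⟩ := exists_nat_ge (M + δ)
    refine ⟨max N N', fun n hn m hm => ?_⟩
    have hm0 : (0 : ℝ) ≤ m := m.cast_nonneg
    refine ge_of_tendsto (tendsto_gprod_right o (x n) (hr m hm0)) ?_
    filter_upwards [hlen m, hUle (eventually_ge_atTop N)] with k hk hkN
    have e₁ := hN n ((le_max_left _ _).trans hn) k hkN
    have e₂ : M + δ ≤ gprod o (x k) (f k m) := by
      have a1 := hf k 0 ⟨le_rfl, dist_nonneg⟩ m ⟨hm0, hk⟩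
      have a2 := hf k (dist o (x k)) ⟨dist_nonneg, le_rfl⟩ m ⟨hm0, hk⟩
      rw [hf0, zero_sub, abs_neg, abs_of_nonneg hm0] at a1
      rw [hf1, abs_of_nonneg (by linarith)] at a2
      have : (N' : ℝ) ≤ m := by exact_mod_cast (le_max_right _ _).trans hm
      simp only [gprod]
      rw [a2, dist_comm (f k m) o, a1, dist_comm (x k) o]
      linarith
    have := hhyp.le_gprod e₁ e₂
    linarith

end Rays

section Lines

variable {X : Type*} [MetricSpace X] {δ : ℝ}

theorem asymp_of_limit (hhyp : IsGromovHyperbolic X δ) {l : Filter ℕ} [l.NeBot] (hl : l ≤ atTop)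
    (o : X) (u : ℕ → ℝ → X) (ρ r : GeodesicRay X) (D : ℝ)
    (hlim : ∀ s ≥ (0 : ℝ), Tendsto (fun n => u n s) l (𝓝 (ρ.toFun s)))
    (hD : ∀ s ≥ (0 : ℝ), ∀ᶠ n in l, s - D ≤ gprod o (u n s) (r.toFun n)) : ρ.Asymp r := by
  refine asymp_of_gprod hhyp ρ r o fun M => ?_
  set d := dist o (r.toFun 0) with hd
  have hd0 : 0 ≤ d := dist_nonneg
  obtain ⟨s, hs0, hsM⟩ : ∃ s ≥ (0 : ℝ), M + |D| + d + δ ≤ s :=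
    ⟨max 0 (M + |D| + d + δ), le_max_left _ _, le_max_right _ _⟩
  refine ⟨s, hs0, s, hs0, ?_⟩
  rw [gprod_comm]
  refine ge_of_tendsto (tendsto_gprod_right o (r.toFun s) (hlim s hs0)) ?_
  obtain ⟨k, hk⟩ := exists_nat_ge s
  filter_upwards [hD s hs0, hl (eventually_ge_atTop k)] with n h1 h2
  have hsn : s ≤ n := hk.trans (by exact_mod_cast h2)
  have e₁ := le_gprod_ray r o hs0 hsn
  rw [gprod_comm] at h1
  have := le_abs_self D
  have e₂ : s - |D| - d - δ ≤ _ :=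
    hhyp.le_gprod (M := s - |D| - d) (by linarith [abs_nonneg D]) (by linarith) (z := r.toFun n)
      (o := o) (x := r.toFun s) (y := u n s)
  linarith

/-- Two distinct boundary points are joined by a geodesic line. -/
theorem exists_line [ProperSpace X] (hhyp : IsGromovHyperbolic X δ) (hgeo : GeodesicSpace X)
    (r r' : GeodesicRay X) (hne : ¬ r.Asymp r') :
    ∃ l : GeodesicLine X, l.posRay.Asymp r ∧ l.negRay.Asymp r' := by
  set o := r.toFun 0 with ho
  obtain ⟨M, hM⟩ : ∃ M : ℝ, ∀ T ≥ (0 : ℝ), ∀ S ≥ (0 : ℝ),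
      gprod o (r.toFun T) (r'.toFun S) < M := by
    by_contra! hcon
    exact hne (asymp_of_gprod hhyp r r' o hcon)
  choose f hf0 hf1 hf using fun n : ℕ => hgeo (r'.toFun n) (r.toFun n)
  set L : ℕ → ℝ := fun n => dist (r'.toFun n) (r.toFun n) with hL
  set τ : ℕ → ℝ := fun n => gprod (r'.toFun n) o (r.toFun n) with hτ
  have hτ0 : ∀ n, 0 ≤ τ n := fun n => gprod_nonneg _ _ _
  have hτL : ∀ n, τ n ≤ L n := fun n => gprod_le_dist_right _ _ _
  set D : ℝ := M + 2 * δ with hD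
  have hdA : ∀ n, ∀ s ∈ Icc 0 (L n), dist (r'.toFun n) (f n s) = s := fun n s hs => by
    have := hf n 0 ⟨le_rfl, dist_nonneg⟩ s hs
    rwa [hf0, zero_sub, abs_neg, abs_of_nonneg hs.1] at this
  have hdB : ∀ n, ∀ s ∈ Icc 0 (L n), dist (r.toFun n) (f n s) = L n - s := fun n s hs => by
    have := hf n (L n) ⟨dist_nonneg, le_rfl⟩ s hs
    rwa [hf1, abs_of_nonneg (by linarith [hs.2])] at this
  have hnear : ∀ n, dist o (f n (τ n)) ≤ D := fun n => by
    have h4 := hhyp.four_point o (f n (τ n)) (r'.toFun n) (r.toFun n)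
    have h1 := hdA n (τ n) ⟨hτ0 n, hτL n⟩
    have h2 := hdB n (τ n) ⟨hτ0 n, hτL n⟩
    rw [dist_comm (f n (τ n)) (r.toFun n), dist_comm (f n (τ n)) (r'.toFun n), h1, h2] at h4
    have h3 : τ n = (dist o (r'.toFun n) + L n - dist o (r.toFun n)) / 2 := by
      simp only [hτ, hL, gprod]; rw [dist_comm (r.toFun n) (r'.toFun n)]
    have h5 := hM n n.cast_nonneg n n.cast_nonneg
    simp only [gprod] at h5
    rw [dist_comm (r.toFun n) o, dist_comm (r'.toFun n) o, dist_comm (r.toFun n) (r'.toFun n)] at h5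
    change dist o (f n (τ n)) + L n ≤ _ at h4
    change (dist o (r.toFun n) + dist o (r'.toFun n) - L n) / 2 < M at h5
    have h6 : max (dist o (r'.toFun n) + (L n - τ n)) (dist o (r.toFun n) + τ n)
      = (dist o (r.toFun n) + dist o (r'.toFun n) + L n) / 2 := by
      rw [max_eq_left] <;> rw [h3] <;> linarith
    rw [h6] at h4
    linarith
  have hlenA : ∀ n : ℕ, n - dist o (r'.toFun 0) - D ≤ τ n := fun n => by
    have h1 := hdA n (τ n) ⟨hτ0 n, hτL n⟩
    have h2 := le_ray_dist_base r' o (t := n) n.cast_nonneg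
    have h3 := dist_triangle_left o (r'.toFun n) (f n (τ n))
    have h4 := hnear n
    rw [dist_comm (f n (τ n)) o, dist_comm (f n (τ n)), h1] at h3
    linarith
  have hlenB : ∀ n : ℕ, n - dist o (r.toFun 0) - D ≤ L n - τ n := fun n => by
    have h1 := hdB n (τ n) ⟨hτ0 n, hτL n⟩
    have h2 := le_ray_dist_base r o (t := n) n.cast_nonneg
    have h3 := dist_triangle_left o (r.toFun n) (f n (τ n))
    have h4 := hnear n
    rw [dist_comm (f n (τ n)) o, dist_comm (f n (τ n)), h1] at h3
    linarith
  set U := hyperfilter ℕ with hU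
  have hUle : (U : Filter ℕ) ≤ atTop := Nat.hyperfilter_le_atTop
  have hevA : ∀ s : ℝ, ∀ᶠ n in (U : Filter ℕ), s ≤ τ n := fun s => by
    obtain ⟨k, hk⟩ := exists_nat_ge (s + dist o (r'.toFun 0) + D)
    filter_upwards [hUle (eventually_ge_atTop k)] with n hn
    have : (k : ℝ) ≤ n := by exact_mod_cast hn
    linarith [hlenA n]
  have hevB : ∀ s : ℝ, ∀ᶠ n in (U : Filter ℕ), s ≤ L n - τ n := fun s => by
    obtain ⟨k, hk⟩ := exists_nat_ge (s + dist o (r.toFun 0) + D)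
    filter_upwards [hUle (eventually_ge_atTop k)] with n hn
    have : (k : ℝ) ≤ n := by exact_mod_cast hn
    linarith [hlenB n]
  have hmem : ∀ s : ℝ, ∀ᶠ n in (U : Filter ℕ), τ n + s ∈ Icc 0 (L n) := fun s => by
    filter_upwards [hevA (-s), hevB s] with n h1 h2
    exact ⟨by linarith, by linarith⟩
  have hdist : ∀ s t : ℝ, ∀ᶠ n in (U : Filter ℕ),
      dist (f n (τ n + s)) (f n (τ n + t)) = |s - t| := fun s t => by
    filter_upwards [hmem s, hmem t] with n h1 h2
    rw [hf n _ h1 _ h2, add_sub_add_left_eq_sub]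
  have hex : ∀ s : ℝ, ∃ y, Tendsto (fun n => f n (τ n + s)) U (𝓝 y) := fun s =>
    exists_ultralimit U (o := o) (R := D + |s|) (by
      filter_upwards [hdist 0 s] with n hn
      rw [zero_sub, abs_neg, add_zero] at hn
      have := dist_triangle o (f n (τ n)) (f n (τ n + s))
      linarith [hnear n])
  choose l hl using hex
  refine ⟨⟨l, fun s _ t _ => ?_⟩, ?_, ?_⟩
  · refine tendsto_nhds_unique ((hl s).dist (hl t)) ?_
    exact tendsto_const_nhds.congr' (by
      filter_upwards [hdist s t] with n hn
      exact hn.symm)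
  · refine asymp_of_limit hhyp hUle o (fun n s => f n (τ n + s)) _ r D (fun s _ => hl s) ?_
    intro s hs
    filter_upwards [hmem s] with n h1
    have h2 := hdB n _ h1
    have h3 := hdB n (τ n) ⟨hτ0 n, hτL n⟩
    have h4 := hf n (τ n) ⟨hτ0 n, hτL n⟩ _ h1
    rw [sub_add_cancel_left, abs_neg, abs_of_nonneg hs] at h4
    have h5 := gprod_base_change (f n (τ n)) o (f n (τ n + s)) (r.toFun n)
    have h6 : gprod (f n (τ n)) (f n (τ n + s)) (r.toFun n) = s := by
      simp only [gprod]
      rw [dist_comm (f n (τ n + s)) (f n (τ n)), h4, h3, dist_comm _ (r.toFun n), h2]; ring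
    have h7 := hnear n
    rw [dist_comm] at h7
    linarith
  · refine asymp_of_limit hhyp hUle o (fun n s => f n (τ n + -s)) _ r' D (fun s _ => hl (-s)) ?_
    intro s hs
    filter_upwards [hmem (-s)] with n h1
    have h2 := hdA n _ h1
    have h3 := hdA n (τ n) ⟨hτ0 n, hτL n⟩
    have h4 := hf n (τ n) ⟨hτ0 n, hτL n⟩ _ h1
    rw [sub_add_cancel_left, neg_neg, abs_of_nonneg hs] at h4
    have h5 := gprod_base_change (f n (τ n)) o (f n (τ n + -s)) (r'.toFun n)
    have h6 : gprod (f n (τ n)) (f n (τ n + -s)) (r'.toFun n) = s := by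
      simp only [gprod]
      rw [dist_comm (f n (τ n + -s)) (f n (τ n)), h4, h3, dist_comm _ (r'.toFun n), h2]; ring
    have h7 := hnear n
    rw [dist_comm] at h7
    linarith

end Lines

section Busemann

variable {X : Type*} [MetricSpace X] {δ : ℝ}

/-- The Busemann function of a geodesic ray. -/
def busemann (r : GeodesicRay X) (x : X) : ℝ := ⨅ n : ℕ, (dist x (r.toFun n) - n)

theorem tendsto_busemann (r : GeodesicRay X) (x : X) :
    Tendsto (fun n : ℕ => dist x (r.toFun n) - n) atTop (𝓝 (busemann r x)) := by
  refine tendsto_atTop_ciInf (fun m n hmn => ?_) ⟨-dist x (r.toFun 0), ?_⟩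
  · have h := ray_dist r m.cast_nonneg n.cast_nonneg
    have hmn' : (m : ℝ) ≤ n := by exact_mod_cast hmn
    rw [abs_of_nonpos (by linarith)] at h
    have := dist_triangle x (r.toFun m) (r.toFun n)
    show dist x (r.toFun n) - n ≤ dist x (r.toFun m) - m
    linarith
  · rintro _ ⟨n, rfl⟩
    have := le_ray_dist_base r x (t := n) n.cast_nonneg
    show _ ≤ dist x (r.toFun n) - n
    linarith

theorem dist_add_busemann_le (hhyp : IsGromovHyperbolic X δ) (r : GeodesicRay X) (x y z : X) :
    dist x y + busemann r z ≤
      max (dist x z + busemann r y) (busemann r x + dist y z) + 2 * δ := by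
  refine le_of_tendsto_of_tendsto' (tendsto_const_nhds.add (tendsto_busemann r z))
    (((tendsto_const_nhds.add (tendsto_busemann r y)).max
      ((tendsto_busemann r x).add tendsto_const_nhds)).add tendsto_const_nhds) fun n => ?_
  have h := hhyp.four_point x y z (r.toFun n)
  have e : max (dist x z + (dist y (r.toFun n) - n)) (dist x (r.toFun n) - n + dist y z)
      = max (dist x z + dist y (r.toFun n)) (dist x (r.toFun n) + dist y z) - n := by
    rw [← max_sub_sub_right]; congr 1 <;> ring
  rw [e]
  linarith

theorem busemann_sub_le_of_asymp (hhyp : IsGromovHyperbolic X δ) {r s : GeodesicRay X}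
    (h : r.Asymp s) (x y : X) :
    busemann r x - busemann r y ≤ busemann s x - busemann s y + 2 * δ := by
  obtain ⟨C, hC⟩ := h
  refine le_of_tendsto_of_tendsto ((tendsto_busemann r x).sub (tendsto_busemann r y))
    (((tendsto_busemann s x).sub (tendsto_busemann s y)).add tendsto_const_nhds) ?_
  obtain ⟨k, hk⟩ := exists_nat_gt
    (dist x y + C + dist x (r.toFun 0) + dist y (s.toFun 0) + 2 * |δ|)
  filter_upwards [eventually_ge_atTop k] with n hn
  have hkn : (k : ℝ) ≤ n := by exact_mod_cast hn
  have h1 := hhyp.four_point x (r.toFun n) y (s.toFun n)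
  have h2 := hC n n.cast_nonneg
  have h3 := le_ray_dist_base r x (t := n) n.cast_nonneg
  have h4 := le_ray_dist_base s y (t := n) n.cast_nonneg
  have := le_abs_self δ
  have h0 : (0 : ℝ) ≤ n := n.cast_nonneg
  have e := dist_comm (r.toFun n) y
  rcases le_total (dist x y + dist (r.toFun n) (s.toFun n))
    (dist x (s.toFun n) + dist (r.toFun n) y) with h5 | h5
  · rw [max_eq_right h5] at h1; linarith
  · rw [max_eq_left h5] at h1; linarith

theorem busemann_rayMap (g : X ≃ᵢ X) (r : GeodesicRay X) (x : X) :
    busemann (rayMap g r) (g x) = busemann r x := by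
  simp only [busemann, rayMap, g.dist_eq]

/-- An isometry fixing the endpoint of a ray coarsely preserves differences of the
Busemann function. -/
theorem abs_busemann_sub_le (hhyp : IsGromovHyperbolic X δ) {r : GeodesicRay X} {g : X ≃ᵢ X}
    (hg : bmap g r.pt = r.pt) (x y : X) :
    |(busemann r (g x) - busemann r (g y)) - (busemann r x - busemann r y)| ≤ 2 * δ := by
  rw [bmap_pt, pt_eq_iff] at hg
  have h1 := busemann_sub_le_of_asymp hhyp hg (g x) (g y)
  have h2 := busemann_sub_le_of_asymp hhyp hg (g y) (g x)
  simp only [busemann_rayMap] at h1 h2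
  rw [abs_le]
  constructor <;> linarith

end Busemann

section Loxodromic

variable {X : Type*} [MetricSpace X] {δ : ℝ}

theorem IsometryEquiv.one_apply' (x : X) : (1 : X ≃ᵢ X) x = x := rfl

/-- Isometries act on the Gromov boundary. -/
instance boundaryAction : MulAction (X ≃ᵢ X) (GromovBoundary X) where
  smul g ξ := bmap g ξ
  one_smul ξ := by
    obtain ⟨r, rfl⟩ := exists_pt_eq ξ
    rfl
  mul_smul g h ξ := by
    obtain ⟨r, rfl⟩ := exists_pt_eq ξ
    rfl

theorem smul_eq_bmap (g : X ≃ᵢ X) (ξ : GromovBoundary X) : g • ξ = bmap g ξ := rfl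

theorem dist_apply_apply (g h : X ≃ᵢ X) (x y : X) :
    dist (g x) (h y) = dist x ((g⁻¹ * h) y) := by
  rw [← g⁻¹.dist_eq (g x), IsometryEquiv.inv_apply_self, IsometryEquiv.mul_apply]

theorem dist_inv_apply (g : X ≃ᵢ X) (x : X) : dist x (g⁻¹ x) = dist x (g x) := by
  rw [← g.dist_eq, IsometryEquiv.apply_inv_self, dist_comm]

theorem gprod_self_left (o x : X) : gprod o o x = 0 := by
  simp [gprod, dist_comm]

theorem GromovScaffold.IsGromovHyperbolic.gprod_le (h : IsGromovHyperbolic X δ) {o x y z : X}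
    {c : ℝ} (h1 : gprod o x y ≤ c) (h2 : c + δ < gprod o z y) : gprod o x z ≤ c + δ := by
  by_contra! h3
  linarith [h o x y z, lt_min h3 h2]

/-- `q` translates `o` along a quasi-geodesic, with constant `C`. -/
structure IsTranslation (o : X) (q : X ≃ᵢ X) (C : ℝ) : Prop where
  cross : ∀ n m : ℕ, gprod o ((q ^ n) o) ((q ^ m)⁻¹ o) ≤ C
  unbounded : ∀ M : ℝ, ∃ N : ℕ, ∀ n ≥ N, M ≤ dist o ((q ^ n) o)

theorem gprod_pow_succ_inv_le (hhyp : IsGromovHyperbolic X δ) (hδ : 0 ≤ δ) {o : X} {q : X ≃ᵢ X}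
    {c : ℝ} (hc : gprod o (q o) (q⁻¹ o) ≤ c) (hq : 2 * c + 4 * δ + 1 ≤ dist o (q o)) (n : ℕ) :
    gprod o ((q ^ n) o) (q⁻¹ o) ≤ c + δ := by
  have hc0 := gprod_nonneg o (q o) (q⁻¹ o)
  induction n with
  | zero =>
    rw [pow_zero, IsometryEquiv.one_apply', gprod_self_left]; linarith
  | succ n ih =>
    have h1 := gprod_add_gprod o (q o) ((q ^ (n + 1)) o)
    have h2 : gprod (q o) o ((q ^ (n + 1)) o) = gprod o (q⁻¹ o) ((q ^ n) o) := by
      rw [← gprod_map q o, IsometryEquiv.apply_inv_self, pow_succ', IsometryEquiv.mul_apply]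
    rw [h2, gprod_comm o (q⁻¹ o)] at h1
    rw [gprod_comm]
    rw [gprod_comm] at hc
    exact hhyp.gprod_le hc (by rw [gprod_comm o ((q ^ (n + 1)) o)]; linarith)

/-- Local-to-global criterion for an isometry to be a translation. -/
theorem isTranslation_of_gprod_le (hhyp : IsGromovHyperbolic X δ) (hδ : 0 ≤ δ) {o : X}
    {q : X ≃ᵢ X} {c : ℝ} (hc : gprod o (q o) (q⁻¹ o) ≤ c)
    (hq : 2 * c + 4 * δ + 1 ≤ dist o (q o)) : IsTranslation o q (c + 2 * δ) := by
  have hc0 := gprod_nonneg o (q o) (q⁻¹ o)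
  have s1 := gprod_pow_succ_inv_le hhyp hδ hc hq
  have s2 := gprod_pow_succ_inv_le hhyp hδ (q := q⁻¹) (o := o) (c := c)
    (by rwa [inv_inv, gprod_comm]) (by rwa [dist_inv_apply])
  simp only [inv_inv, inv_pow] at s2
  refine ⟨fun n m => ?_, fun M => ?_⟩
  · rcases m with _ | m
    · rw [pow_zero, inv_one, IsometryEquiv.one_apply', gprod_comm, gprod_self_left]
      linarith
    · have h1 := gprod_add_gprod o (q⁻¹ o) ((q ^ (m + 1))⁻¹ o)
      have h2 : gprod (q⁻¹ o) o ((q ^ (m + 1))⁻¹ o) = gprod o (q o) ((q ^ m)⁻¹ o) := by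
        rw [← gprod_map q⁻¹ o, IsometryEquiv.inv_apply_self, pow_succ, mul_inv_rev,
          IsometryEquiv.mul_apply]
      rw [h2, gprod_comm o (q o), dist_inv_apply, gprod_comm o (q⁻¹ o)] at h1
      have := hhyp.gprod_le (s1 n) (z := (q ^ (m + 1))⁻¹ o) (by linarith [s2 m])
      linarith
  · have h : ∀ n : ℕ, (n : ℝ) ≤ dist o ((q ^ n) o) := by
      intro n
      induction n with
      | zero => simp
      | succ n ih =>
        have h1 := s1 n
        have h2 : dist ((q ^ n) o) (q⁻¹ o) = dist o ((q ^ (n + 1)) o) := by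
          rw [← q.dist_eq, IsometryEquiv.apply_inv_self, pow_succ', IsometryEquiv.mul_apply,
            dist_comm]
        simp only [gprod] at h1
        rw [h2, dist_comm _ o, dist_comm _ o, dist_inv_apply] at h1
        push_cast
        linarith
    obtain ⟨N, hN⟩ := exists_nat_ge M
    refine ⟨N, fun n hn => hN.trans (le_trans ?_ (h n))⟩
    exact_mod_cast hn

variable {o : X} {q : X ≃ᵢ X} {C : ℝ}

theorem IsTranslation.inv (h : IsTranslation o q C) : IsTranslation o q⁻¹ C := by
  refine ⟨fun n m => ?_, fun M => ?_⟩
  · simp only [inv_pow, inv_inv]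
    rw [gprod_comm]
    exact h.cross m n
  · obtain ⟨N, hN⟩ := h.unbounded M
    refine ⟨N, fun n hn => ?_⟩
    rw [inv_pow, dist_inv_apply]
    exact hN n hn

theorem IsTranslation.nonneg (h : IsTranslation o q C) : 0 ≤ C :=
  (gprod_nonneg _ _ _).trans (h.cross 0 0)

theorem dist_pow_add (n m : ℕ) :
    dist o ((q ^ (n + m)) o) = dist ((q ^ n) o) ((q ^ m)⁻¹ o) := by
  rw [dist_comm ((q ^ n) o), dist_apply_apply, inv_inv, ← pow_add, add_comm]

theorem IsTranslation.dist_add_dist_le (h : IsTranslation o q C) (n m : ℕ) :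
    dist o ((q ^ n) o) + dist o ((q ^ m) o) ≤ dist o ((q ^ (n + m)) o) + 2 * C := by
  have h1 := h.cross n m
  simp only [gprod] at h1
  rw [← dist_pow_add, dist_comm _ o, dist_comm _ o, dist_inv_apply] at h1
  linarith

theorem IsTranslation.le_gprod_of_le (h : IsTranslation o q C) {m n : ℕ} (hmn : m ≤ n) :
    dist o ((q ^ m) o) - C ≤ gprod o ((q ^ m) o) ((q ^ n) o) := by
  obtain ⟨k, rfl⟩ := Nat.exists_eq_add_of_le hmn
  have h1 := h.dist_add_dist_le m k
  have h2 : dist ((q ^ m) o) ((q ^ (m + k)) o) = dist o ((q ^ k) o) := by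
    rw [pow_add, IsometryEquiv.mul_apply, (q ^ m).dist_eq]
  simp only [gprod]
  rw [h2, dist_comm _ o, dist_comm _ o]
  linarith

theorem IsTranslation.min_sub_le_gprod (h : IsTranslation o q C) (m n : ℕ) :
    min (dist o ((q ^ m) o)) (dist o ((q ^ n) o)) - C ≤ gprod o ((q ^ m) o) ((q ^ n) o) := by
  rcases le_total m n with hmn | hmn
  · exact (sub_le_sub_right (min_le_left _ _) C).trans (h.le_gprod_of_le hmn)
  · rw [gprod_comm]
    exact (sub_le_sub_right (min_le_right _ _) C).trans (h.le_gprod_of_le hmn)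

theorem IsTranslation.exists_rayConv [ProperSpace X] (hhyp : IsGromovHyperbolic X δ)
    (hgeo : GeodesicSpace X) (h : IsTranslation o q C) :
    ∃ r : GeodesicRay X, RayConv o (fun n => (q ^ n) o) r := by
  refine _root_.exists_rayConv hhyp hgeo o _ fun M => ?_
  obtain ⟨N, hN⟩ := h.unbounded (M + C)
  refine ⟨N, fun n hn m hm => le_trans ?_ (h.min_sub_le_gprod n m)⟩
  have := le_min (hN n hn) (hN m hm)
  linarith

theorem IsTranslation.bmap_eq (hhyp : IsGromovHyperbolic X δ) (h : IsTranslation o q C)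
    {r : GeodesicRay X} (hr : RayConv o (fun n => (q ^ n) o) r) : bmap q r.pt = r.pt := by
  rw [bmap_pt, pt_eq_iff]
  refine (hr.map q).asymp hhyp hr fun M N => ?_
  obtain ⟨N', hN'⟩ := h.unbounded (M + C)
  refine ⟨max N N', le_max_left _ _, max N N', le_max_left _ _, ?_⟩
  rw [← IsometryEquiv.mul_apply, ← pow_succ']
  refine le_trans ?_ (h.min_sub_le_gprod _ _)
  have := le_min (hN' (max N N' + 1) (by omega)) (hN' (max N N') (by omega))
  linarith

theorem rayConv_self (o : X) (r : GeodesicRay X) : RayConv o (fun n => r.toFun n) r := fun M => by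
  obtain ⟨N, hN⟩ := exists_nat_ge (M + dist o (r.toFun 0))
  refine ⟨N, fun n hn m hm => ?_⟩
  have hn' : (N : ℝ) ≤ n := by exact_mod_cast hn
  have hm' : (N : ℝ) ≤ m := by exact_mod_cast hm
  rcases le_total n m with h | h
  · linarith [le_gprod_ray r o n.cast_nonneg (show (n : ℝ) ≤ m by exact_mod_cast h)]
  · rw [gprod_comm]
    linarith [le_gprod_ray r o m.cast_nonneg (show (m : ℝ) ≤ n by exact_mod_cast h)]

theorem RayConv.exists_gprod_lt (hhyp : IsGromovHyperbolic X δ) {x y : ℕ → X}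
    {r s : GeodesicRay X} (hx : RayConv o x r) (hy : RayConv o y s) (h : ¬ r.Asymp s) :
    ∃ M : ℝ, ∃ N : ℕ, ∀ n ≥ N, ∀ m ≥ N, gprod o (x n) (y m) < M := by
  by_contra! hcon
  exact h (hx.asymp hhyp hy hcon)

theorem dist_sub_le_busemann (r : GeodesicRay X) {x : X} {M : ℝ}
    (h : ∀ᶠ m : ℕ in atTop, gprod o x (r.toFun m) ≤ M) :
    dist o x - 2 * M ≤ busemann r x - busemann r o := by
  refine ge_of_tendsto ((tendsto_busemann r x).sub (tendsto_busemann r o)) ?_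
  filter_upwards [h] with m hm
  simp only [gprod] at hm
  rw [dist_comm x o, dist_comm (r.toFun m) o] at hm
  linarith

theorem IsTranslation.not_asymp (h : IsTranslation o q C) {r r' : GeodesicRay X}
    (hhyp : IsGromovHyperbolic X δ)
    (hr : RayConv o (fun n => (q ^ n) o) r) (hr' : RayConv o (fun n => (q⁻¹ ^ n) o) r') :
    ¬ r.Asymp r' := by
  intro has
  obtain ⟨N₁, h₁⟩ := hr (C + δ + 1)
  obtain ⟨N₂, h₂⟩ := (hr'.congr_asymp ((asymp_equivalence X).symm has)) (C + δ + 1)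
  have e₁ := h₁ (max N₁ N₂) (le_max_left _ _) (max N₁ N₂) (le_max_left _ _)
  have e₂ := h₂ (max N₁ N₂) (le_max_right _ _) (max N₁ N₂) (le_max_right _ _)
  rw [gprod_comm] at e₂
  have e₃ := hhyp.le_gprod e₁ e₂
  have e₄ := h.cross (max N₁ N₂) (max N₁ N₂)
  simp only [inv_pow] at e₃
  linarith

/-- A translation fixes exactly its two endpoints. -/
theorem IsTranslation.fixed_eq (h : IsTranslation o q C) {r r' : GeodesicRay X}
    (hhyp : IsGromovHyperbolic X δ)
    (hr : RayConv o (fun n => (q ^ n) o) r) (hr' : RayConv o (fun n => (q⁻¹ ^ n) o) r') :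
    {ξ : GromovBoundary X | bmap q ξ = ξ} = {r.pt, r'.pt} := by
  apply Set.Subset.antisymm
  · intro ξ hξ
    by_contra hcon
    obtain ⟨s, rfl⟩ := exists_pt_eq ξ
    rw [mem_insert_iff, mem_singleton_iff, not_or, pt_eq_iff, pt_eq_iff] at hcon
    have hs : ∀ n : ℕ, bmap (q ^ n) s.pt = s.pt := fun n => by
      have : q ∈ MulAction.stabilizer (X ≃ᵢ X) s.pt := hξ
      exact pow_mem this n
    obtain ⟨M₁, N₁, h₁⟩ := hr.exists_gprod_lt hhyp (rayConv_self o s)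
      fun h => hcon.1 ((asymp_equivalence X).symm h)
    obtain ⟨M₂, N₂, h₂⟩ := hr'.exists_gprod_lt hhyp (rayConv_self o s)
      fun h => hcon.2 ((asymp_equivalence X).symm h)
    obtain ⟨N₃, h₃⟩ := h.unbounded (M₁ + M₂ + δ + 1)
    set n := max (max N₁ N₂) N₃ with hn
    have hn₁ : N₁ ≤ n := by omega
    have hn₂ : N₂ ≤ n := by omega
    have hn₃ : N₃ ≤ n := by omega
    have b₁ := dist_sub_le_busemann (o := o) (x := (q ^ n) o) (M := M₁) s (by
      filter_upwards [eventually_ge_atTop N₁] with m hm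
      exact (h₁ n hn₁ m hm).le)
    have b₂ := dist_sub_le_busemann (o := o) (x := (q⁻¹ ^ n) o) (M := M₂) s (by
      filter_upwards [eventually_ge_atTop N₂] with m hm
      exact (h₂ n hn₂ m hm).le)
    have b₃ := abs_busemann_sub_le hhyp (hs n) o ((q ^ n)⁻¹ o)
    rw [IsometryEquiv.apply_inv_self, abs_le] at b₃
    rw [inv_pow, dist_inv_apply] at b₂
    linarith [h₃ n hn₃, b₃.2]
  · rintro ξ (rfl | rfl)
    · exact h.bmap_eq hhyp hr
    · have h1 := h.inv.bmap_eq hhyp hr'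
      have : q⁻¹ ∈ MulAction.stabilizer (X ≃ᵢ X) r'.pt := h1
      exact inv_mem_iff.1 this

theorem IsTranslation.isLoxodromic [ProperSpace X] (hhyp : IsGromovHyperbolic X δ)
    (hgeo : GeodesicSpace X) (h : IsTranslation o q C) : IsLoxodromic q := by
  obtain ⟨r, hr⟩ := h.exists_rayConv hhyp hgeo
  obtain ⟨r', hr'⟩ := h.inv.exists_rayConv hhyp hgeo
  exact ⟨r.pt, r'.pt, fun e => h.not_asymp hhyp hr hr' (pt_eq_iff.1 e), h.fixed_eq hhyp hr hr'⟩

theorem axisSet_nonempty [ProperSpace X] (hhyp : IsGromovHyperbolic X δ)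
    (hgeo : GeodesicSpace X) (h : IsLoxodromic q) : (axisSet q).Nonempty := by
  obtain ⟨a, b, hab, hfix⟩ := h
  obtain ⟨r, rfl⟩ := exists_pt_eq a
  obtain ⟨r', rfl⟩ := exists_pt_eq b
  obtain ⟨l, h₁, h₂⟩ := exists_line hhyp hgeo r r' fun e => hab (pt_eq_iff.2 e)
  exact ⟨l.toFun 0, l, ⟨r.pt, r'.pt, hab, hfix, pt_eq_iff.2 h₁, pt_eq_iff.2 h₂⟩, 0, rfl⟩

theorem exists_crossing (a : ℕ → ℝ) {S E T : ℝ} {N : ℕ} (hS : 0 ≤ S) (hE : 0 ≤ E) (h0 : a 0 ≤ T)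
    (hstep : ∀ k, a (k + 1) ≤ a k + S) (hN : T ≤ a N + E) :
    ∃ k ≤ N, a k ≤ T ∧ T ≤ a k + S + E := by
  have key : ∀ n : ℕ, a n ≤ T ∨ ∃ k ≤ n, a k ≤ T ∧ T ≤ a k + S := by
    intro n
    induction n with
    | zero => exact Or.inl h0
    | succ n ih =>
      rcases ih with h | ⟨k, hk, h⟩
      · by_cases h' : a (n + 1) ≤ T
        · exact Or.inl h'
        · exact Or.inr ⟨n, n.le_succ, h, by linarith [hstep n]⟩
      · exact Or.inr ⟨k, hk.trans n.le_succ, h⟩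
  rcases key N with h | ⟨k, hk, h, h'⟩
  · exact ⟨N, le_rfl, h, by linarith⟩
  · exact ⟨k, hk, h, by linarith⟩

theorem gprod_lt_of_mem_line (hhyp : IsGromovHyperbolic X δ) (hδ : 0 ≤ δ) (l : GeodesicLine X)
    {u v : ℕ → X} (hu : RayConv o u l.posRay) (hv : RayConv o v l.negRay) {x : X}
    (hx : x ∈ range l.toFun) : ∃ N : ℕ, ∀ n ≥ N, gprod x (u n) (v n) < 2 * δ + 1 := by
  obtain ⟨s, rfl⟩ := hx
  obtain ⟨N₁, h₁⟩ := hu.base_change (l.toFun s) (2 * δ + 1)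
  obtain ⟨N₂, h₂⟩ := hv.base_change (l.toFun s) (2 * δ + 1)
  obtain ⟨N₃, h₃⟩ := exists_nat_ge |s|
  set m := max (max N₁ N₂) N₃ with hm
  have hm₁ : N₁ ≤ m := by omega
  have hm₂ : N₂ ≤ m := by omega
  have hm₃ : |s| ≤ m := h₃.trans (by exact_mod_cast le_max_right _ _)
  have hzero : gprod (l.toFun s) (l.toFun m) (l.toFun (-m)) = 0 := by
    simp only [gprod]
    rw [abs_le] at hm₃
    rw [l.geodesic _ trivial _ trivial, l.geodesic _ trivial _ trivial,
      l.geodesic _ trivial _ trivial, abs_of_nonneg (by linarith), abs_of_nonpos (by linarith),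
      abs_of_nonneg (by linarith [(Nat.cast_nonneg m : (0 : ℝ) ≤ m)])]
    ring
  refine ⟨m, fun n hn => ?_⟩
  by_contra! hcon
  have e₁ : 2 * δ + 1 ≤ gprod (l.toFun s) (u n) (l.toFun m) := h₁ n (hm₁.trans hn) m hm₁
  have e₂ : 2 * δ + 1 ≤ gprod (l.toFun s) (v n) (l.toFun (-m)) := h₂ n (hm₂.trans hn) m hm₂
  rw [gprod_comm] at e₁
  have e₃ := hhyp.le_gprod e₁ hcon
  have e₄ := hhyp.le_gprod e₃ (by linarith)
  linarith

/-- The axis of a translation lies in a bounded neighbourhood of an orbit of its powers. -/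
theorem IsTranslation.exists_dist_le [ProperSpace X] (hhyp : IsGromovHyperbolic X δ) (hδ : 0 ≤ δ)
    (hgeo : GeodesicSpace X) (h : IsTranslation o q C) {x : X} (hx : x ∈ axisSet q) :
    ∃ k : ℤ, dist x ((q ^ k) o) ≤ 2 * C + dist o (q o) + 6 * δ + 2 := by
  obtain ⟨r, hr⟩ := h.exists_rayConv hhyp hgeo
  obtain ⟨r', hr'⟩ := h.inv.exists_rayConv hhyp hgeo
  obtain ⟨l, ⟨a, b, -, hfix, hl₁, hl₂⟩, hxl⟩ := hx
  rw [h.fixed_eq hhyp hr hr', Set.pair_eq_pair_iff] at hfix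
  obtain ⟨N, hN⟩ : ∃ N : ℕ, ∀ n ≥ N, gprod x ((q⁻¹ ^ n) o) ((q ^ n) o) < 2 * δ + 1 := by
    rcases hfix with ⟨e₁, e₂⟩ | ⟨e₁, e₂⟩
    · obtain ⟨N, hN⟩ := gprod_lt_of_mem_line hhyp hδ l
        (hr.congr_asymp (pt_eq_iff.1 (e₁.trans hl₁.symm)))
        (hr'.congr_asymp (pt_eq_iff.1 (e₂.trans hl₂.symm))) hxl
      exact ⟨N, fun n hn => by rw [gprod_comm]; exact hN n hn⟩
    · exact gprod_lt_of_mem_line hhyp hδ l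
        (hr'.congr_asymp (pt_eq_iff.1 (e₂.trans hl₁.symm)))
        (hr.congr_asymp (pt_eq_iff.1 (e₁.trans hl₂.symm))) hxl
  have hg := hN N le_rfl
  set A := (q⁻¹ ^ N) o with hA
  set B := (q ^ N) o with hB
  have hAq : ∀ k : ℕ, dist A ((q ^ k) A) = dist o ((q ^ k) o) := fun k => by
    rw [hA, ← IsometryEquiv.mul_apply, (((Commute.refl q).inv_left.pow_pow N k).symm).eq,
      IsometryEquiv.mul_apply, (q⁻¹ ^ N).dist_eq]
  have hBA : B = (q ^ (N + N)) A := by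
    rw [hA, hB, pow_add, inv_pow, IsometryEquiv.mul_apply, IsometryEquiv.apply_inv_self]
  have hAB : dist A B = dist o ((q ^ (N + N)) o) := by rw [hBA, hAq]
  have hAx : dist A x + dist x B < dist A B + 2 * (2 * δ + 1) := by
    simp only [gprod] at hg
    rw [dist_comm B x] at hg
    linarith
  obtain ⟨k, hk, h₁, h₂⟩ := exists_crossing (fun k => dist o ((q ^ k) o)) (S := dist o (q o))
    (E := 2 * (2 * δ + 1)) (T := dist A x) (N := N + N) dist_nonneg (by linarith)
    (by simp) (fun k => by
      have := dist_triangle o ((q ^ k) o) ((q ^ (k + 1)) o)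
      rwa [pow_succ, IsometryEquiv.mul_apply, (q ^ k).dist_eq] at this)
    (by
      show _ ≤ dist o ((q ^ (N + N)) o) + _
      rw [← hAB]
      have := dist_nonneg (x := x) (y := B)
      linarith)
  obtain ⟨j, hj⟩ := Nat.exists_eq_add_of_le hk
  refine ⟨(k : ℤ) - N, ?_⟩
  have hz : (q ^ ((k : ℤ) - N)) o = (q ^ k) A := by
    rw [zpow_sub, zpow_natCast, zpow_natCast, IsometryEquiv.mul_apply, hA, inv_pow]
  have hzB : dist ((q ^ k) A) B = dist o ((q ^ j) o) := by
    rw [hBA, hj, pow_add, IsometryEquiv.mul_apply, (q ^ k).dist_eq, hAq]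
  have hadd := h.dist_add_dist_le k j
  rw [← hj, ← hAB] at hadd
  have h4 := hhyp.four_point x ((q ^ k) A) A B
  rw [hzB, dist_comm ((q ^ k) A) A, hAq, dist_comm x A] at h4
  rw [hz]
  have hmax : max (dist A x + dist o ((q ^ j) o)) (dist x B + dist o ((q ^ k) o)) ≤
      dist A B + 2 * C + dist o (q o) + 2 * (2 * δ + 1) := by
    have := dist_nonneg (x := o) (y := q o)
    have := h.nonneg
    apply max_le
    · linarith
    · linarith
  linarith

end Loxodromic

section FiniteOrbit

variable {X : Type*} [MetricSpace X] {δ : ℝ} {o : X} {Γ : Subgroup (X ≃ᵢ X)}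

theorem bmap_inv_eq {g : X ≃ᵢ X} {ξ : GromovBoundary X} (h : bmap g ξ = ξ) : bmap g⁻¹ ξ = ξ :=
  (MulAction.stabilizer (X ≃ᵢ X) ξ).inv_mem h

theorem bmap_mul_eq {g h : X ≃ᵢ X} {ξ : GromovBoundary X} (hg : bmap g ξ = ξ)
    (hh : bmap h ξ = ξ) : bmap (g * h) ξ = ξ :=
  (MulAction.stabilizer (X ≃ᵢ X) ξ).mul_mem hg hh

theorem bmap_pow_eq {g : X ≃ᵢ X} {ξ : GromovBoundary X} (h : bmap g ξ = ξ) (n : ℕ) :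
    bmap (g ^ n) ξ = ξ :=
  (MulAction.stabilizer (X ≃ᵢ X) ξ).pow_mem h n

/-- The coarse translation length of `g` towards the endpoint of `r`. -/
def drift (r : GeodesicRay X) (o : X) (g : X ≃ᵢ X) : ℝ := busemann r (g o) - busemann r o

theorem abs_drift_mul_sub_le (hhyp : IsGromovHyperbolic X δ) {r : GeodesicRay X} {g : X ≃ᵢ X}
    (hg : bmap g r.pt = r.pt) (h : X ≃ᵢ X) :
    |drift r o (g * h) - drift r o g - drift r o h| ≤ 2 * δ := by
  have := abs_busemann_sub_le hhyp hg (h o) o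
  rw [← IsometryEquiv.mul_apply] at this
  convert this using 2
  simp only [drift]; ring

theorem drift_one (r : GeodesicRay X) (o : X) : drift r o 1 = 0 := by
  simp [drift]

/-- An element with large drift away from the fixed point is a translation. -/
theorem isTranslation_of_drift (hhyp : IsGromovHyperbolic X δ) (hδ : 0 ≤ δ) {r : GeodesicRay X}
    {t : X ≃ᵢ X} (ht : bmap t r.pt = r.pt) {M : ℝ} (hM : 0 ≤ M)
    (hd : dist o (t o) - 2 * M ≤ drift r o t) (hlarge : 4 * M + 10 * δ + 1 ≤ dist o (t o)) :
    IsTranslation o t (M + 3 * δ) := by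
  have h1 := abs_le.1 (abs_drift_mul_sub_le (o := o) hhyp ht t⁻¹)
  rw [mul_inv_cancel, drift_one] at h1
  have h2 := dist_add_busemann_le hhyp r o (t⁻¹ o) (t o)
  rw [dist_inv_apply] at h2
  simp only [drift] at hd h1
  have h3 : 2 * dist o (t o) - 2 * M - 2 * δ ≤ dist (t⁻¹ o) (t o) := by
    rcases max_cases (dist o (t o) + busemann r (t⁻¹ o)) (busemann r o + dist (t⁻¹ o) (t o))
      with ⟨e, -⟩ | ⟨e, -⟩ <;> rw [e] at h2 <;> linarith
  have h4 : gprod o (t o) (t⁻¹ o) ≤ M + δ := by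
    simp only [gprod]
    rw [dist_comm _ o, dist_comm _ o, dist_inv_apply, dist_comm (t o)]
    linarith
  have := isTranslation_of_gprod_le hhyp hδ h4 (by linarith)
  convert this using 1
  ring

theorem dist_sub_le_drift_pow (hhyp : IsGromovHyperbolic X δ) (hδ : 0 ≤ δ) {r : GeodesicRay X}
    {t : X ≃ᵢ X} (ht : bmap t r.pt = r.pt) {M : ℝ} (hM : 0 ≤ M)
    (hd : dist o (t o) - 2 * M ≤ drift r o t) (hlarge : 4 * M + 10 * δ + 1 ≤ dist o (t o))
    (n : ℕ) : dist o ((t ^ n) o) - (2 * M + 2 * δ) ≤ drift r o (t ^ n) := by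
  have htr := isTranslation_of_drift hhyp hδ ht hM hd hlarge
  rcases n with _ | n
  · rw [pow_zero, drift_one]
    simp only [IsometryEquiv.one_apply', dist_self]
    linarith
  · have h1 := dist_add_busemann_le hhyp r o ((t ^ (n + 1)) o) (t o)
    have h2 := htr.dist_add_dist_le 1 n
    have h3 : dist ((t ^ (n + 1)) o) (t o) = dist o ((t ^ n) o) := by
      rw [pow_succ', IsometryEquiv.mul_apply, t.dist_eq, dist_comm]
    rw [pow_one, add_comm 1 n] at h2
    rw [h3] at h1
    simp only [drift] at hd ⊢
    rcases max_cases (dist o (t o) + busemann r ((t ^ (n + 1)) o))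
      (busemann r o + dist o ((t ^ n) o)) with ⟨e, -⟩ | ⟨e, -⟩ <;> rw [e] at h1 <;> linarith

/-- Elements of a properly acting group that fix a boundary point, have bounded drift and
coexist with a translation fixing that point are finite in number. -/
theorem finite_drift_le (hhyp : IsGromovHyperbolic X δ) (hδ : 0 ≤ δ) (hproper : ProperAct Γ)
    {r : GeodesicRay X} {t : X ≃ᵢ X} (htΓ : t ∈ Γ) (ht : bmap t r.pt = r.pt) {E : ℝ}
    (hE : ∀ n : ℕ, dist o ((t ^ n) o) - E ≤ drift r o (t ^ n))
    (hunb : ∀ M : ℝ, ∃ N : ℕ, ∀ n ≥ N, M ≤ dist o ((t ^ n) o)) (S : ℝ) :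
    {u : X ≃ᵢ X | u ∈ Γ ∧ bmap u r.pt = r.pt ∧ |drift r o u| ≤ S}.Finite := by
  set R := E + S + 6 * δ with hR
  have hconj : ∀ u : X ≃ᵢ X, bmap u r.pt = r.pt → |drift r o u| ≤ S →
      ∀ᶠ n : ℕ in atTop, dist o ((t ^ n * u * (t ^ n)⁻¹) o) ≤ R := by
    intro u hu hS
    obtain ⟨N, hN⟩ := hunb (dist o (u o) + |S| + |E| + 10 * δ + 1)
    filter_upwards [eventually_ge_atTop N] with n hn
    have hlarge := hN n hn
    set p := (t ^ n)⁻¹ o with hp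
    have hpo : dist o p = dist o ((t ^ n) o) := dist_inv_apply _ _
    have hgoal : dist o ((t ^ n * u * (t ^ n)⁻¹) o) = dist p (u p) := by
      rw [hp, dist_apply_apply, inv_inv, mul_assoc, IsometryEquiv.mul_apply,
        IsometryEquiv.mul_apply, IsometryEquiv.mul_apply]
    have h1 := abs_le.1 (abs_drift_mul_sub_le (o := o) hhyp (bmap_pow_eq ht n) (t ^ n)⁻¹)
    rw [mul_inv_cancel, drift_one] at h1
    have hbp : busemann r p - busemann r o ≤ -dist o p + E + 2 * δ := by
      have : busemann r p - busemann r o = drift r o (t ^ n)⁻¹ := rfl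
      rw [this, hpo]
      linarith [hE n]
    rw [← hpo] at hlarge
    have h2 := abs_le.1 (abs_busemann_sub_le hhyp hu p o)
    have hS' := abs_le.1 hS
    simp only [drift] at hS'
    have h3 := dist_add_busemann_le hhyp r o (u p) (u o)
    have h4 := dist_add_busemann_le hhyp r p (u p) o
    rw [u.dist_eq, dist_comm p o] at h3
    rw [dist_comm p o, dist_comm (u p) o] at h4
    have h5 : dist o p - dist o (u o) ≤ dist o (u p) := by
      have := dist_triangle (u o) o (u p)
      rw [u.dist_eq, dist_comm (u o) o] at this
      linarith
    have h6 : dist o (u p) ≤ dist o p + S + 2 * δ := by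
      have := le_abs_self S
      have := le_abs_self E
      have := abs_nonneg E
      have := abs_nonneg S
      rcases max_cases (dist o (u o) + busemann r (u p)) (busemann r o + dist o p)
        with ⟨e, -⟩ | ⟨e, -⟩ <;> rw [e] at h3 <;> linarith
    rw [hgoal]
    rcases max_cases (dist o p + busemann r (u p)) (busemann r p + dist o (u p))
      with ⟨e, -⟩ | ⟨e, -⟩ <;> rw [e] at h4 <;> linarith
  have hfin := hproper o R
  by_contra hinf
  obtain ⟨F, hF, hcard⟩ := Set.Infinite.exists_subset_card_eq hinf (hfin.toFinset.card + 1)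
  have hev : ∀ᶠ n : ℕ in atTop, ∀ u ∈ F, dist o ((t ^ n * u * (t ^ n)⁻¹) o) ≤ R :=
    (Filter.eventually_all_finset F).2 fun u hu => hconj u (hF hu).2.1 (hF hu).2.2
  obtain ⟨n, hn⟩ := hev.exists
  have hle := Finset.card_le_card_of_injOn (s := F) (t := hfin.toFinset)
    (fun u => t ^ n * u * (t ^ n)⁻¹) (fun u hu => by
      rw [Finset.mem_coe, Set.Finite.mem_toFinset]
      exact ⟨Γ.mul_mem (Γ.mul_mem (Γ.pow_mem htΓ n) (hF hu).1) (Γ.inv_mem (Γ.pow_mem htΓ n)),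
        hn u hu⟩) (fun u _ v _ h => by simpa using h)
  omega

theorem exists_seq_fixing {ξ : GromovBoundary X} (hfin : (MulAction.orbit Γ ξ).Finite) (ξ' : GromovBoundary X)
    (h : ξ' ∈ limitSet Γ o) : ∃ g : ℕ → X ≃ᵢ X, ∃ s : GeodesicRay X, s.pt = ξ' ∧
      (∀ n, g n ∈ Γ) ∧ (∀ n, bmap (g n) ξ = ξ) ∧ RayConv o (fun n => g n o) s := by
  obtain ⟨g, -, hconv⟩ := h
  obtain ⟨s, hs, hgs⟩ := exists_rayConv_of_seqConv hconv
  have hc : ∀ y : GromovBoundary X, ∃ c ∈ Γ, y ∈ MulAction.orbit Γ ξ → bmap c ξ = y := by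
    intro y
    by_cases hy : y ∈ MulAction.orbit Γ ξ
    · obtain ⟨c, rfl⟩ := hy
      exact ⟨c, c.2, fun _ => rfl⟩
    · exact ⟨1, Γ.one_mem, fun h => absurd h hy⟩
  choose c hcΓ hc using hc
  obtain ⟨D, hD⟩ := (hfin.image fun y => dist o (c y o)).bddAbove
  have horb : ∀ n, bmap (g n : X ≃ᵢ X)⁻¹ ξ ∈ MulAction.orbit Γ ξ := fun n => ⟨(g n)⁻¹, rfl⟩
  refine ⟨fun n => g n * c (bmap (g n : X ≃ᵢ X)⁻¹ ξ), s, hs,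
    fun n => Γ.mul_mem (g n).2 (hcΓ _), fun n => ?_, hgs.congr_dist (D := D) fun n => ?_⟩
  · rw [← smul_eq_bmap, mul_smul, smul_eq_bmap (c _), hc _ (horb n), ← smul_eq_bmap,
      smul_inv_smul]
  · rw [IsometryEquiv.mul_apply, (g n : X ≃ᵢ X).dist_eq]
    exact hD ⟨_, horb n, rfl⟩

theorem exists_dist_sub_le_drift (hhyp : IsGromovHyperbolic X δ) {g : ℕ → X ≃ᵢ X}
    {r s : GeodesicRay X} (hg : RayConv o (fun n => g n o) s) (hrs : s.pt ≠ r.pt) :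
    ∃ M : ℝ, ∃ N : ℕ, ∀ n ≥ N, dist o (g n o) - 2 * M ≤ drift r o (g n) := by
  obtain ⟨M, N, h⟩ := hg.exists_gprod_lt hhyp (rayConv_self o r) fun e => hrs (pt_eq_iff.2 e)
  refine ⟨M, N, fun n hn => dist_sub_le_busemann r ?_⟩
  filter_upwards [eventually_ge_atTop N] with m hm
  exact (h n hn m hm).le

/-- A properly acting non-elementary group has no finite orbit on the Gromov boundary. -/
theorem orbit_infinite (hhyp : IsGromovHyperbolic X δ) (hδ : 0 ≤ δ) (hproper : ProperAct Γ)
    (hne : NonElementary Γ o) (ξ : GromovBoundary X) : (MulAction.orbit Γ ξ).Infinite := by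
  intro hfin
  obtain ⟨η, η', hη, hη', hηη', hηξ, hη'ξ⟩ : ∃ η η', η ∈ limitSet Γ o ∧ η' ∈ limitSet Γ o ∧
      η ≠ η' ∧ η ≠ ξ ∧ η' ≠ ξ := by
    obtain ⟨a, b, c, ha, hb, hc, hab, hac, hbc⟩ := hne
    by_cases h1 : a = ξ
    · exact ⟨b, c, hb, hc, hbc, fun h => hab (h1.trans h.symm), fun h => hac (h1.trans h.symm)⟩
    · by_cases h2 : b = ξ
      · exact ⟨a, c, ha, hc, hac, h1, fun h => hbc (h2.trans h.symm)⟩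
      · exact ⟨a, b, ha, hb, hab, h1, h2⟩
  obtain ⟨r, rfl⟩ := exists_pt_eq ξ
  obtain ⟨g, s, rfl, hgΓ, hgξ, hgs⟩ := exists_seq_fixing hfin η hη
  obtain ⟨g', s', rfl, hgΓ', hgξ', hgs'⟩ := exists_seq_fixing hfin η' hη'
  obtain ⟨M₁, N₁, h₁⟩ := exists_dist_sub_le_drift hhyp hgs hηξ
  obtain ⟨M₂, N₂, h₂⟩ := exists_dist_sub_le_drift hhyp hgs' hη'ξ
  set M := max 0 (max M₁ M₂) with hM
  have hM0 : 0 ≤ M := le_max_left _ _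
  have hM₁ : M₁ ≤ M := (le_max_left _ _).trans (le_max_right _ _)
  have hM₂ : M₂ ≤ M := (le_max_right _ _).trans (le_max_right _ _)
  have hbig : ∀ K : ℝ, ∃ N : ℕ, ∀ n ≥ N, K ≤ dist o (g n o) := fun K => by
    obtain ⟨N, hN⟩ := hgs K
    exact ⟨N, fun n hn => (hN n hn n hn).trans (gprod_le_dist_left _ _ _)⟩
  have hbig' : ∀ K : ℝ, ∃ N : ℕ, ∀ n ≥ N, K ≤ dist o (g' n o) := fun K => by
    obtain ⟨N, hN⟩ := hgs' K
    exact ⟨N, fun n hn => (hN n hn n hn).trans (gprod_le_dist_left _ _ _)⟩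
  obtain ⟨N₃, h₃⟩ := hbig (4 * M + 10 * δ + 1)
  set t := g (max N₁ N₃) with ht
  have htΓ : t ∈ Γ := hgΓ _
  have htξ : bmap t r.pt = r.pt := hgξ _
  have htd : dist o (t o) - 2 * M ≤ drift r o t := by
    linarith [h₁ (max N₁ N₃) (le_max_left _ _)]
  have htl : 4 * M + 10 * δ + 1 ≤ dist o (t o) := h₃ _ (le_max_right _ _)
  have htr := isTranslation_of_drift hhyp hδ htξ hM0 htd htl
  have htE := dist_sub_le_drift_pow hhyp hδ htξ hM0 htd htl
  have hfinite := finite_drift_le hhyp hδ hproper htΓ htξ htE htr.unbounded (drift r o t + 4 * δ)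
  obtain ⟨D, hD⟩ := (hfinite.image fun u => dist o (u o)).bddAbove
  have hpow : ∀ u ∈ Γ, bmap u r.pt = r.pt → 0 ≤ drift r o u →
      ∃ m : ℕ, dist ((t ^ m) o) (u o) ≤ D := by
    intro u hu huξ hu0
    obtain ⟨N, hN⟩ := htr.unbounded (drift r o u + (2 * M + 2 * δ))
    obtain ⟨k, -, hk₁, hk₂⟩ := exists_crossing (fun k => drift r o (t ^ k))
      (S := drift r o t + 2 * δ) (E := 0) (T := drift r o u) (N := N) (by linarith) le_rfl
      (by simpa [drift_one] using hu0)
      (fun k => by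
        have := abs_le.1 (abs_drift_mul_sub_le (o := o) hhyp (bmap_pow_eq htξ k) t)
        rw [← pow_succ] at this
        linarith)
      (by linarith [hN N le_rfl, htE N])
    refine ⟨k, ?_⟩
    rw [dist_apply_apply]
    refine hD ⟨(t ^ k)⁻¹ * u, ⟨Γ.mul_mem (Γ.inv_mem (Γ.pow_mem htΓ k)) hu,
      bmap_mul_eq (bmap_inv_eq (bmap_pow_eq htξ k)) huξ, ?_⟩, rfl⟩
    have := abs_le.1 (abs_drift_mul_sub_le (o := o) hhyp (bmap_pow_eq htξ k) ((t ^ k)⁻¹ * u))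
    rw [mul_inv_cancel_left] at this
    rw [abs_le]
    constructor <;> linarith
  refine hηη' (pt_eq_iff.2 (hgs.asymp hhyp hgs' fun K N => ?_))
  obtain ⟨N₄, h₄⟩ := hbig (max (2 * M) (K + 3 * D + (M + 3 * δ)))
  obtain ⟨N₅, h₅⟩ := hbig' (max (2 * M) (K + 3 * D + (M + 3 * δ)))
  set n := max N (max N₁ N₄) with hn
  set m := max N (max N₂ N₅) with hm
  refine ⟨n, le_max_left _ _, m, le_max_left _ _, ?_⟩
  have a₁ := h₁ n (by omega)
  have a₂ := h₂ m (by omega)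
  have a₄ := max_le_iff.1 (h₄ n (by omega))
  have a₅ := max_le_iff.1 (h₅ m (by omega))
  obtain ⟨i, hi⟩ := hpow (g n) (hgΓ n) (hgξ n) (by linarith)
  obtain ⟨j, hj⟩ := hpow (g' m) (hgΓ' m) (hgξ' m) (by linarith)
  have b₁ := dist_triangle o ((t ^ i) o) (g n o)
  have b₂ := dist_triangle o ((t ^ j) o) (g' m o)
  have b₃ := htr.min_sub_le_gprod i j
  have b₄ := gprod_lipschitz_left o ((t ^ i) o) (g n o) ((t ^ j) o)
  have b₅ := gprod_lipschitz_right o (g n o) ((t ^ j) o) (g' m o)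
  have b₆ := le_min (show K + 2 * D + (M + 3 * δ) ≤ dist o ((t ^ i) o) by linarith)
    (show K + 2 * D + (M + 3 * δ) ≤ dist o ((t ^ j) o) by linarith)
  linarith

end FiniteOrbit

section Escaping

variable {X : Type*} [MetricSpace X] {δ : ℝ} {o : X} {Γ : Subgroup (X ≃ᵢ X)}

open scoped Pointwise in
/-- A non-elementary properly acting group can move any finite set of boundary points off any
other finite set. -/
theorem exists_bmap_notMem (hhyp : IsGromovHyperbolic X δ) (hδ : 0 ≤ δ) (hproper : ProperAct Γ)
    (hne : NonElementary Γ o) {E F : Set (GromovBoundary X)} (hE : E.Finite) (hF : F.Finite) :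
    ∃ γ ∈ Γ, ∀ a ∈ E, bmap γ a ∉ F := by
  classical
  by_contra! hcon
  have hc : ∀ p : GromovBoundary X × GromovBoundary X, ∃ c : Γ, ∀ γ : Γ,
      bmap (γ : X ≃ᵢ X) p.1 = p.2 → bmap (c : X ≃ᵢ X) p.1 = p.2 := by
    intro p
    by_cases h : ∃ γ : Γ, bmap (γ : X ≃ᵢ X) p.1 = p.2
    · exact ⟨h.choose, fun _ _ => h.choose_spec⟩
    · exact ⟨1, fun γ hγ => absurd ⟨γ, hγ⟩ h⟩
  choose c hc using hc
  have hcov : ⋃ p ∈ (hE.prod hF).toFinset,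
      c p • ((MulAction.stabilizer Γ p.1 : Subgroup Γ) : Set Γ) = univ := by
    refine eq_univ_iff_forall.2 fun γ => ?_
    obtain ⟨a, ha, haF⟩ := hcon γ γ.2
    refine mem_iUnion₂.2 ⟨(a, bmap (γ : X ≃ᵢ X) a), by simp [ha, haF], ?_⟩
    rw [Set.mem_smul_set_iff_inv_smul_mem, SetLike.mem_coe, MulAction.mem_stabilizer_iff,
      smul_eq_mul, mul_smul, inv_smul_eq_iff]
    exact (hc (a, bmap (γ : X ≃ᵢ X) a) γ rfl).symm
  obtain ⟨p, -, hfi⟩ := Subgroup.exists_finiteIndex_of_leftCoset_cover hcov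
  refine orbit_infinite hhyp hδ hproper hne p.1 (Set.finite_of_ncard_ne_zero ?_)
  rw [← MulAction.index_stabilizer]
  exact hfi.index_ne_zero

/-- If no element of `H` meets the quantitative criterion for being a translation, then the long
elements of `H` all move the basepoint in the same direction. -/
theorem le_gprod_of_no_translation (hhyp : IsGromovHyperbolic X δ) (hδ : 0 ≤ δ)
    {H : Subgroup (X ≃ᵢ X)}
    (hH : ∀ h ∈ H, dist o (h o) < 2 * gprod o (h o) (h⁻¹ o) + 4 * δ + 1) {M : ℝ} (hM : 0 ≤ M)
    {g h : X ≃ᵢ X} (hg : g ∈ H) (hh : h ∈ H) (hgl : 4 * M + 20 * δ + 10 ≤ dist o (g o))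
    (hhl : 4 * M + 20 * δ + 10 ≤ dist o (h o)) : M ≤ gprod o (g o) (h o) := by
  by_contra! hcon
  have hg' := hH g hg
  have hh' := hH h hh
  have h1 : gprod o (h o) (g⁻¹ o) ≤ M + δ :=
    hhyp.gprod_le (y := g o) (by rw [gprod_comm]; exact hcon.le)
      (by rw [gprod_comm]; linarith)
  have h2 : gprod o (g⁻¹ o) (h⁻¹ o) ≤ M + δ + δ :=
    hhyp.gprod_le (y := h o) (by rw [gprod_comm]; exact h1) (by rw [gprod_comm]; linarith)
  have e1 : dist (g⁻¹ o) (h⁻¹ o) = dist o ((g * h⁻¹) o) := by rw [dist_apply_apply, inv_inv]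
  have e2 : dist ((g * h⁻¹) o) (g o) = dist o (h o) := by
    rw [dist_comm, dist_apply_apply, inv_mul_cancel_left, dist_inv_apply]
  have e3 : dist ((g * h⁻¹)⁻¹ o) (h o) = dist o (g o) := by
    rw [dist_comm, dist_apply_apply, mul_inv_rev, inv_inv, inv_mul_cancel_left, dist_inv_apply]
  have hw := hH _ (H.mul_mem hg (H.inv_mem hh))
  have i1 := dist_inv_apply g o
  have i2 := dist_inv_apply h o
  have i3 := dist_inv_apply (g * h⁻¹) o
  have hlen : dist o (g o) + dist o (h o) - 2 * M - 4 * δ ≤ dist o ((g * h⁻¹) o) := by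
    simp only [gprod] at h2
    rw [e1, dist_comm _ o, dist_comm _ o, i1, i2] at h2
    linarith
  have h3 : dist o (g o) - M - 2 * δ ≤ gprod o ((g * h⁻¹) o) (g o) := by
    simp only [gprod]
    rw [e2, dist_comm _ o, dist_comm _ o]
    linarith
  have h4 : dist o (h o) - M - 2 * δ ≤ gprod o ((g * h⁻¹)⁻¹ o) (h o) := by
    simp only [gprod]
    rw [e3, dist_comm _ o, dist_comm _ o, i3]
    linarith
  have h5 : gprod o (h o) ((g * h⁻¹) o) ≤ M + δ :=
    hhyp.gprod_le (y := g o) (by rw [gprod_comm]; exact hcon.le) (by linarith)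
  have h6 : gprod o ((g * h⁻¹) o) ((g * h⁻¹)⁻¹ o) ≤ M + δ + δ :=
    hhyp.gprod_le (y := h o) (by rw [gprod_comm]; exact h5) (by linarith)
  linarith

/-- An infinite properly acting group without translations fixes a boundary point. -/
theorem exists_fixed_of_no_translation [ProperSpace X] (hhyp : IsGromovHyperbolic X δ)
    (hδ : 0 ≤ δ) (hgeo : GeodesicSpace X) (hproper : ProperAct Γ) {H : Subgroup (X ≃ᵢ X)}
    (hHΓ : H ≤ Γ) (hinf : (H : Set (X ≃ᵢ X)).Infinite)
    (hH : ∀ h ∈ H, dist o (h o) < 2 * gprod o (h o) (h⁻¹ o) + 4 * δ + 1) :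
    ∃ ξ : GromovBoundary X, ∀ h ∈ H, bmap h ξ = ξ := by
  have hlong : ∀ n : ℕ, ∃ h ∈ H, (n : ℝ) ≤ dist o (h o) := by
    intro n
    by_contra! hcon
    exact hinf ((hproper o n).subset fun h hh => ⟨hHΓ hh, (hcon h hh).le⟩)
  choose f hfH hf using hlong
  have hbig : ∀ M : ℝ, ∃ N : ℕ, ∀ n ≥ N, M ≤ dist o (f n o) := fun M => by
    obtain ⟨N, hN⟩ := exists_nat_ge M
    exact ⟨N, fun n hn => hN.trans ((Nat.cast_le.2 hn).trans (hf n))⟩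
  obtain ⟨r, hr⟩ := exists_rayConv hhyp hgeo o (fun n => f n o) fun M => by
    obtain ⟨N, hN⟩ := hbig (4 * max M 0 + 20 * δ + 10)
    exact ⟨N, fun n hn m hm => (le_max_left M 0).trans
      (le_gprod_of_no_translation hhyp hδ hH (le_max_right _ _) (hfH n) (hfH m) (hN n hn)
        (hN m hm))⟩
  refine ⟨r.pt, fun h hh => ?_⟩
  rw [bmap_pt, pt_eq_iff]
  refine (hr.map h).asymp hhyp hr fun M N => ?_
  obtain ⟨N', hN'⟩ := hbig (4 * max M 0 + 20 * δ + 10 + dist o (h o))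
  have hn := hN' (max N N') (le_max_right _ _)
  refine ⟨max N N', le_max_left _ _, max N N', le_max_left _ _, (le_max_left M 0).trans ?_⟩
  refine le_gprod_of_no_translation hhyp hδ hH (le_max_right _ _) (H.mul_mem hh (hfH _)) (hfH _)
    ?_ ?_
  · have := dist_triangle (h o) o (h (f (max N N') o))
    rw [h.dist_eq, dist_comm (h o) o] at this
    rw [IsometryEquiv.mul_apply]
    linarith
  · linarith [dist_nonneg (x := o) (y := h o)]

/-- A confined subgroup of a non-elementary group contains a translation. -/
theorem exists_isTranslation_of_confined [ProperSpace X] (hhyp : IsGromovHyperbolic X δ)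
    (hδ : 0 ≤ δ) (hgeo : GeodesicSpace X) (hproper : ProperAct Γ) (hne : NonElementary Γ o)
    {H : Subgroup (X ≃ᵢ X)} (hHΓ : H ≤ Γ) (P : Finset (X ≃ᵢ X))
    (hconf : ∀ γ ∈ Γ, ∃ h ∈ H, γ * h * γ⁻¹ ∈ P ∧ γ * h * γ⁻¹ ≠ 1)
    (hP : ∀ p ∈ P, p ≠ 1 → IsLoxodromic p) : ∃ q ∈ H, ∃ C, IsTranslation o q C := by
  by_contra! hcon
  have hH : ∀ h ∈ H, dist o (h o) < 2 * gprod o (h o) (h⁻¹ o) + 4 * δ + 1 := by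
    intro h hh
    by_contra! hle
    exact hcon h hh _ (isTranslation_of_gprod_le hhyp hδ le_rfl hle)
  have hfix : ∀ p ∈ P, p ≠ 1 → {ξ : GromovBoundary X | bmap p ξ = ξ}.Finite ∧
      {ξ : GromovBoundary X | bmap p ξ = ξ}.Nonempty := by
    intro p hp hp1
    obtain ⟨a, b, -, h⟩ := hP p hp hp1
    rw [h]
    exact ⟨by simp, by simp⟩
  have hF : (⋃ p ∈ {p : X ≃ᵢ X | p ∈ P ∧ p ≠ 1}, {ξ : GromovBoundary X | bmap p ξ = ξ}).Finite :=
    (P.finite_toSet.subset fun p hp => hp.1).biUnion fun p hp => (hfix p hp.1 hp.2).1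
  have hconj : ∀ (γ h : X ≃ᵢ X) (ξ : GromovBoundary X),
      bmap (γ * h * γ⁻¹) (bmap γ ξ) = bmap γ ξ ↔ bmap h ξ = ξ := by
    intro γ h ξ
    simp only [← smul_eq_bmap]
    rw [mul_smul, inv_smul_smul, mul_smul, smul_left_cancel_iff]
  by_cases hinf : (H : Set (X ≃ᵢ X)).Infinite
  · obtain ⟨ξ, hξ⟩ := exists_fixed_of_no_translation hhyp hδ hgeo hproper hHΓ hinf hH
    obtain ⟨γ, hγ, h⟩ := exists_bmap_notMem hhyp hδ hproper hne (Set.finite_singleton ξ) hF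
    obtain ⟨x, hx, hxP⟩ := hconf γ hγ
    exact h ξ rfl (mem_biUnion (s := {p : X ≃ᵢ X | p ∈ P ∧ p ≠ 1}) hxP
      ((hconj γ x ξ).2 (hξ x hx)))
  · have hE : (⋃ h ∈ {h : X ≃ᵢ X | h ∈ H ∧ {ξ : GromovBoundary X | bmap h ξ = ξ}.Finite},
        {ξ : GromovBoundary X | bmap h ξ = ξ}).Finite :=
      ((Set.not_infinite.1 hinf).subset fun h hh => hh.1).biUnion fun h hh => hh.2
    obtain ⟨γ, hγ, h⟩ := exists_bmap_notMem hhyp hδ hproper hne hE hF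
    obtain ⟨x, hx, hxP⟩ := hconf γ hγ
    obtain ⟨hfin, η, hη⟩ := hfix _ hxP.1 hxP.2
    have hη' : bmap γ (bmap γ⁻¹ η) = η := smul_inv_smul γ η
    refine h (bmap γ⁻¹ η) (mem_biUnion
      (s := {h : X ≃ᵢ X | h ∈ H ∧ {ξ : GromovBoundary X | bmap h ξ = ξ}.Finite}) (x := x)
      ⟨hx, ?_⟩ ?_) ?_
    · refine (hfin.preimage (f := bmap γ) (MulAction.injective γ).injOn).subset fun ξ hξ => ?_
      exact (hconj γ x ξ).2 hξ
    · refine (hconj γ x _).1 ?_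
      rw [hη']
      exact hη
    · rw [hη']
      exact mem_biUnion (s := {p : X ≃ᵢ X | p ∈ P ∧ p ≠ 1}) hxP hη

theorem IsTranslation.conj {q : X ≃ᵢ X} {C : ℝ} (h : IsTranslation o q C) (g : X ≃ᵢ X) :
    IsTranslation (g o) (g * q * g⁻¹) C := by
  refine ⟨fun n m => ?_, fun M => ?_⟩
  · rw [conj_pow, conj_pow, conj_inv]
    simp only [IsometryEquiv.mul_apply, IsometryEquiv.inv_apply_self, gprod_map]
    exact h.cross n m
  · obtain ⟨N, hN⟩ := h.unbounded M
    refine ⟨N, fun n hn => (hN n hn).trans_eq ?_⟩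
    rw [conj_pow]
    simp only [IsometryEquiv.mul_apply, IsometryEquiv.inv_apply_self, g.dist_eq]

/-- Cosets of a subgroup of infinite index leave every ball. -/
theorem exists_forall_le_dist (hproper : ProperAct Γ) {G : Subgroup (X ≃ᵢ X)} (hle : G ≤ Γ)
    (hindex : (G.subgroupOf Γ).index = 0) (o : X) (M : ℝ) :
    ∃ γ ∈ Γ, ∀ g ∈ G, M ≤ dist o (g (γ⁻¹ o)) := by
  by_contra! hcon
  have hB : {b : Γ | dist o ((b : X ≃ᵢ X) o) ≤ M}.Finite :=
    Set.Finite.of_finite_image ((hproper o M).subset (by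
      rintro _ ⟨b, hb, rfl⟩
      exact ⟨b.2, hb⟩)) Subtype.val_injective.injOn
  have : Finite {b : Γ | dist o ((b : X ≃ᵢ X) o) ≤ M} := hB
  have : Finite (Γ ⧸ G.subgroupOf Γ) :=
    Finite.of_surjective
      (fun b : {b : Γ | dist o ((b : X ≃ᵢ X) o) ≤ M} => ((b.1⁻¹ : Γ) : Γ ⧸ G.subgroupOf Γ)) (by
      intro x
      obtain ⟨γ, rfl⟩ := QuotientGroup.mk_surjective x
      obtain ⟨g, hg, hlt⟩ := hcon γ γ.2
      refine ⟨⟨⟨g, hle hg⟩ * γ⁻¹, hlt.le⟩, ?_⟩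
      refine QuotientGroup.eq.2 ?_
      rw [inv_inv, Subgroup.mem_subgroupOf]
      simpa using hg)
  exact Subgroup.index_ne_zero_of_finite hindex

/-- The limit along an ultrafilter of the conjugates `γₙ G γₙ⁻¹` of a subgroup. -/
def limitConj {A : Type*} [Group A] (U : Ultrafilter ℕ) (γ : ℕ → A) (G : Subgroup A) :
    Subgroup A where
  carrier := {h | ∀ᶠ n in (U : Filter ℕ), (γ n)⁻¹ * h * γ n ∈ G}
  one_mem' := by simp [G.one_mem]
  mul_mem' {a b} ha hb := by
    filter_upwards [ha, hb] with n h₁ h₂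
    convert G.mul_mem h₁ h₂ using 1
    group
  inv_mem' {a} ha := by
    filter_upwards [ha] with n h
    convert G.inv_mem h using 1
    group

theorem mem_limitConj {A : Type*} [Group A] {U : Ultrafilter ℕ} {γ : ℕ → A} {G : Subgroup A}
    {h : A} : h ∈ limitConj U γ G ↔ ∀ᶠ n in (U : Filter ℕ), (γ n)⁻¹ * h * γ n ∈ G := Iff.rfl

theorem limitConj_confined {A : Type*} [Group A] {Γ G : Subgroup A} (U : Ultrafilter ℕ)
    {γ : ℕ → A} (hγ : ∀ n, γ n ∈ Γ) {P : Finset A}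
    (hconf : ∀ a ∈ Γ, ∃ g ∈ G, a * g * a⁻¹ ∈ P ∧ a * g * a⁻¹ ≠ 1) :
    ∀ a ∈ Γ, ∃ h ∈ limitConj U γ G, a * h * a⁻¹ ∈ P ∧ a * h * a⁻¹ ≠ 1 := by
  intro a ha
  have hev : ∀ᶠ n in (U : Filter ℕ), ∃ p ∈ {p : A | p ∈ P ∧ p ≠ 1},
      (γ n)⁻¹ * (a⁻¹ * p * a) * γ n ∈ G := by
    refine Eventually.of_forall fun n => ?_
    obtain ⟨g, hg, hp⟩ := hconf (a * γ n) (Γ.mul_mem ha (hγ n))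
    refine ⟨_, hp, ?_⟩
    convert hg using 1
    group
  obtain ⟨p, hp, h⟩ := (Ultrafilter.eventually_exists_mem_iff
    (P.finite_toSet.subset fun p hp => hp.1)).1 hev
  have he : a * (a⁻¹ * p * a) * a⁻¹ = p := by group
  exact ⟨a⁻¹ * p * a, mem_limitConj.2 h, by rw [he]; exact hp⟩

/-- A translation based far away from the orbit `G • o` has a far away axis. -/
theorem le_infDist_GAxis [ProperSpace X] (hhyp : IsGromovHyperbolic X δ) (hδ : 0 ≤ δ)
    (hgeo : GeodesicSpace X) {G : Subgroup (X ≃ᵢ X)} {q : X ≃ᵢ X} (hq : q ∈ G) {x : X} {C M : ℝ}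
    (h : IsTranslation x q C) (hM : ∀ g ∈ G, M ≤ dist o (g x)) :
    M - (2 * C + dist x (q x) + 6 * δ + 2) ≤ infDist o (GAxis G q) := by
  obtain ⟨y, hy⟩ := axisSet_nonempty hhyp hgeo (h.isLoxodromic hhyp hgeo)
  have hne : (GAxis G q).Nonempty := ⟨_, mem_biUnion G.one_mem (mem_image_of_mem _ hy)⟩
  refine (le_infDist hne).2 fun z hz => ?_
  obtain ⟨g, hg, w, hw, rfl⟩ := mem_iUnion₂.1 hz
  obtain ⟨k, hk⟩ := h.exists_dist_le hhyp hδ hgeo hw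
  have h₁ := hM (g * q ^ k) (G.mul_mem hg (G.zpow_mem hq k))
  have h₂ := dist_triangle o (g w) (g ((q ^ k) x))
  rw [IsometryEquiv.mul_apply] at h₁
  rw [g.dist_eq] at h₂
  linarith

end Escaping

/-- escaping loxodromic elements in confined subgroups. -/
theorem escaping_loxodromics_of_confined_subgroup
    {X : Type*} [MetricSpace X] [ProperSpace X]
    (δ : ℝ) (hδ : 0 ≤ δ) (hhyp : IsGromovHyperbolic X δ) (hgeo : GeodesicSpace X)
    (Γ G : Subgroup (X ≃ᵢ X)) (hproper : ProperAct Γ)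
    (o : X) (hnonelem : NonElementary Γ o)
    (hle : G ≤ Γ)
    (hGinf : (G : Set (X ≃ᵢ X)).Infinite)
    (hindex : (G.subgroupOf Γ).index = 0)
    (P : Finset (X ≃ᵢ X))
    (hconfined : ∀ γ ∈ Γ, ∃ g ∈ G, γ * g * γ⁻¹ ∈ P ∧ γ * g * γ⁻¹ ≠ 1)
    (hPlox : ∀ p ∈ P, p ≠ 1 → IsLoxodromic p) :
    ∃ h : ℕ → X ≃ᵢ X,
      (∀ n, h n ∈ G) ∧ (∀ n, IsLoxodromic (h n)) ∧
      Filter.Tendsto (fun n => Metric.infDist o (GAxis G (h n))) Filter.atTop Filter.atTop := by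
  choose γ hγ hfar using fun n : ℕ => exists_forall_le_dist hproper hle hindex o n
  set U : Ultrafilter ℕ := hyperfilter ℕ with hU
  have hHΓ : limitConj U γ G ≤ Γ := by
    intro h hh
    obtain ⟨n, hn⟩ := (mem_limitConj.1 hh).exists
    convert Γ.mul_mem (Γ.mul_mem (hγ n) (hle hn)) (Γ.inv_mem (hγ n)) using 1
    group
  obtain ⟨q, hq, C, hC⟩ := exists_isTranslation_of_confined hhyp hδ hgeo hproper hnonelem hHΓ P
    (limitConj_confined U hγ hconfined) hPlox
  have hUtop : (U : Filter ℕ) ≤ atTop := Nat.hyperfilter_le_atTop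
  have hex : ∀ k : ℕ, ∃ h ∈ G, IsLoxodromic h ∧ (k : ℝ) ≤ infDist o (GAxis G h) := by
    intro k
    obtain ⟨K, hK⟩ := exists_nat_ge (k + (2 * C + dist o (q o) + 6 * δ + 2))
    obtain ⟨n, hn, hKn⟩ := ((mem_limitConj.1 hq).and (hUtop (eventually_ge_atTop K))).exists
    have htr := hC.conj (γ n)⁻¹
    rw [inv_inv] at htr
    refine ⟨_, hn, htr.isLoxodromic hhyp hgeo, ?_⟩
    have h₁ := le_infDist_GAxis hhyp hδ hgeo hn htr (hfar n)
    have h₂ : dist ((γ n)⁻¹ o) (((γ n)⁻¹ * q * γ n) ((γ n)⁻¹ o)) = dist o (q o) := by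
      simp only [IsometryEquiv.mul_apply, IsometryEquiv.apply_inv_self, IsometryEquiv.dist_eq]
    have h₃ : (K : ℝ) ≤ n := Nat.cast_le.2 hKn
    rw [h₂] at h₁
    linarith
  choose h hG hlox hinf using hex
  exact ⟨h, hG, hlox, tendsto_atTop_mono hinf tendsto_natCast_atTop_atTop⟩
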